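/- Let d ≥ 2. Given 0 < η < π/100, C ≥ 10 and ε > 0, there exists ρ̃₀ > 0 such that the following holds for every ρ ∈ (0,ρ̃₀), all r,s ∈ ℝᵈ∖{0} with ‖s‖ ≥ C⁻¹ and φ(r,s) > 2η, and every C¹ function β: V_r^η → ℝᵈ with sup‖β‖ ≤ C and ‖D_hβ‖ ≤ C for all unit tangent vectors h. Let Ω = {v ∈ V_r^η : (ρβ(v)+ℝ_{>0}v) ∩ (s+B_ρᵈ) ≠ ∅}, and for v ∈ Ω let τ(v) = inf{t > 0 : ρβ(v)+tv ∈ s+B_ρᵈ}, let W(v) ∈ S₁^{d−1} be the point with ρβ(v)+τ(v)v = s+ρW(v), and let V(v) = v − 2(v·W(v))W(v). Then: (i) the restriction V̄ of V to V⁻¹(V_s^η) is a C¹ diffeomorphism onto V_s^η; (ii) for every Borel M ⊂ V_s^η with λ_s(M) > 0, if μ is vol_{S₁^{d−1}} restricted to V̄⁻¹(M) and rescaled to a probability measure, then V̄_*μ = g · λ_s(M)⁻¹·λ_s|_M for some continuous g: M → [1−ε,1+ε]; (iii) the map B: V_s^η → S₁^{d−1} defined by B(u) = β_{V̄⁻¹(u)}(u)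 = W(V̄⁻¹(u)) is C¹ and satisfies ‖B(u) − β_{ŝ}(u)‖ < ε for all u ∈ V_s^η, and ‖D_hB‖ < C_η for all unit tangent vectors h at points of V_s^η. -/

import Mathlib

open MeasureTheory Metric Set Filter InnerProductGeometry
open scoped Topology ENNReal RealInnerProductSpace

noncomputable section

/-- Euclidean space `ℝᵈ`. -/
abbrev Vec (d : ℕ) : Type := EuclideanSpace ℝ (Fin d)

/-- The unit sphere `S₁^{d-1} ⊂ ℝᵈ`. -/
def sph (d : ℕ) : Set (Vec d) := Metric.sphere (0 : Vec d) 1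

/-- The Lebesgue surface measure on the unit sphere, viewed as a measure on `ℝᵈ`. -/
def sphVol (d : ℕ) : Measure (Vec d) :=
  Measure.map Subtype.val (volume : Measure (Vec d)).toSphere

/-- Normalized direction `Ŝ = S/‖S‖`. -/
def dir {d : ℕ} (x : Vec d) : Vec d := ‖x‖⁻¹ • x

/-- Direction of the outgoing ray after specular reflection in the unit sphere, for an
incoming ray of direction `ŝ = s/‖s‖` passing through the point `x` of the disc
`{ŝ}^⊥ ∩ B₁ᵈ`. -/
def scatterDir {d : ℕ} (s x : Vec d) : Vec d :=
  dir s - (2 * ⟪dir s, x - Real.sqrt (1 - ‖x‖ ^ 2) • dir s⟫) •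
    (x - Real.sqrt (1 - ‖x‖ ^ 2) • dir s)

/-- `(d-1)`-dimensional Lebesgue measure on the unit disc `{s}^⊥ ∩ B₁ᵈ`. -/
def discMeas {d : ℕ} (s : Vec d) : Measure (Vec d) :=
  (μH[(d : ℝ) - 1]).restrict {x | ⟪x, s⟫ = 0 ∧ ‖x‖ < 1}

/-- The exit-direction law `λ_s`. -/
def lamS {d : ℕ} (s : Vec d) : Measure (Vec d) :=
  (discMeas s Set.univ)⁻¹ • Measure.map (scatterDir s) (discMeas s)

/-- `V_s^η = {u ∈ S₁^{d-1} : φ(u,s) > η}`. -/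
def Vseta {d : ℕ} (s : Vec d) (η : ℝ) : Set (Vec d) :=
  {u ∈ sph d | η < angle u s}

/-- The impact location `β_v(u) = (u-v)/‖u-v‖` at which specular reflection in the unit
sphere maps incoming direction `v` to outgoing direction `u`. -/
def impact {d : ℕ} (v u : Vec d) : Vec d := ‖u - v‖⁻¹ • (u - v)

/-- The constant `C_η = 1 + sup ‖D_h β_v(u)‖`. -/
def Ceta (d : ℕ) (η : ℝ) : ℝ :=
  1 + sSup {c | ∃ v ∈ sph d, ∃ u ∈ sph d, η < angle u v ∧
    ∃ h : Vec d, ⟪u, h⟫ = 0 ∧ ‖h‖ = 1 ∧ c = ‖fderiv ℝ (impact v) u h‖}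

/-- First hitting time of the ball `s + B_ρᵈ` along the ray `ρβ(v) + ℝ_{>0}v`. -/
def tauB {d : ℕ} (ρ : ℝ) (s : Vec d) (β : Vec d → Vec d) (v : Vec d) : ℝ :=
  sInf {t | 0 < t ∧ ρ • β v + t • v ∈ ball s ρ}

/-- The directions whose ray hits the ball `s + B_ρᵈ`. -/
def Omega {d : ℕ} (ρ : ℝ) (r s : Vec d) (η : ℝ) (β : Vec d → Vec d) : Set (Vec d) :=
  {v ∈ Vseta r η | ∃ t > (0:ℝ), ρ • β v + t • v ∈ ball s ρ}

/-- The impact location `W(v)` on the unit sphere, `ρβ(v) + τ(v)v = s + ρW(v)`. -/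
def Wmap {d : ℕ} (ρ : ℝ) (s : Vec d) (β : Vec d → Vec d) (v : Vec d) : Vec d :=
  ρ⁻¹ • (ρ • β v + tauB ρ s β v • v - s)

/-- The outgoing direction `V(v)` after specular reflection. -/
def Vmap {d : ℕ} (ρ : ℝ) (s : Vec d) (β : Vec d → Vec d) (v : Vec d) : Vec d :=
  v - (2 * ⟪v, Wmap ρ s β v⟫) • Wmap ρ s β v

/-- The domain `Δ = V⁻¹(V_s^η)` of the restricted scattering map `V̄`. -/
def Delta {d : ℕ} (ρ : ℝ) (r s : Vec d) (η : ℝ) (β : Vec d → Vec d) : Set (Vec d) :=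
  {v ∈ Omega ρ r s η β | Vmap ρ s β v ∈ Vseta s η}

/-- `f` is C¹ on `s` (with derivatives along `s`). -/
def C1On {d : ℕ} (f : Vec d → Vec d) (s : Set (Vec d)) : Prop :=
  ∃ Df : Vec d → Vec d →L[ℝ] Vec d, ContinuousOn Df s ∧
    ∀ x ∈ s, HasFDerivWithinAt f (Df x) s x

section ScatteringMap

variable {d : ℕ}

/-- Orthogonal projection onto the complement of the unit vector `n`. -/
def proj (n : Vec d) : Vec d →L[ℝ] Vec d :=
  ContinuousLinearMap.id ℝ _ - (innerSL ℝ n).smulRight n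

theorem proj_apply (n h : Vec d) : proj n h = h - ⟪n, h⟫ • n := by
  simp [proj]

theorem norm_proj_le {n : Vec d} (hn : ‖n‖ = 1) : ‖proj n‖ ≤ 1 := by
  refine ContinuousLinearMap.opNorm_le_bound _ zero_le_one fun h => ?_
  rw [one_mul, proj_apply]
  refine le_of_sq_le_sq ?_ (norm_nonneg _)
  rw [norm_sub_sq_real, norm_smul, inner_smul_right, hn, real_inner_comm, Real.norm_eq_abs,
    mul_one, sq_abs]
  nlinarith [sq_nonneg ⟪n, h⟫]

theorem norm_proj_sub_proj_le {n k : Vec d} (hn : ‖n‖ = 1) (hk : ‖k‖ = 1) :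
    ‖proj n - proj k‖ ≤ 2 * ‖n - k‖ := by
  refine ContinuousLinearMap.opNorm_le_bound _ (by positivity) fun h => ?_
  have : (proj n - proj k) h = ⟪k - n, h⟫ • k + ⟪n, h⟫ • (k - n) := by
    simp only [sub_apply, proj_apply, inner_sub_left, sub_smul, smul_sub]
    abel
  rw [this]
  calc _ ≤ ‖⟪k - n, h⟫ • k‖ + ‖⟪n, h⟫ • (k - n)‖ := norm_add_le _ _
    _ ≤ (‖k - n‖ * ‖h‖) * ‖k‖ + (‖n‖ * ‖h‖) * ‖k - n‖ := by
      rw [norm_smul, norm_smul]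
      gcongr <;> exact norm_inner_le_norm _ _
    _ = 2 * ‖n - k‖ * ‖h‖ := by rw [hn, hk, norm_sub_rev k n]; ring

theorem norm_dir {y : Vec d} (hy : y ≠ 0) : ‖dir y‖ = 1 := by
  simp [dir, norm_smul, hy]

theorem norm_dir_le (y : Vec d) : ‖dir y‖ ≤ 1 := by
  rcases eq_or_ne y 0 with rfl | hy
  · simp [dir]
  · exact (norm_dir hy).le

theorem norm_smul_dir (y : Vec d) : ‖y‖ • dir y = y := by
  rcases eq_or_ne y 0 with rfl | hy
  · simp [dir]
  · rw [dir, smul_smul, mul_inv_cancel₀ (norm_ne_zero_iff.2 hy), one_smul]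

theorem dir_smul {c : ℝ} (hc : 0 < c) (y : Vec d) : dir (c • y) = dir y := by
  rw [dir, dir, norm_smul, smul_smul, Real.norm_of_nonneg hc.le]
  congr 1
  field_simp

theorem dir_of_norm_eq_one {y : Vec d} (hy : ‖y‖ = 1) : dir y = y := by
  simp [dir, hy]

theorem impact_eq_dir (v u : Vec d) : impact v u = dir (u - v) := rfl

theorem norm_dir_sub_dir_le (y : Vec d) {z : Vec d} (hz : z ≠ 0) :
    ‖dir y - dir z‖ ≤ 2 * ‖y - z‖ / ‖z‖ := by
  have hz' : 0 < ‖z‖ := norm_pos_iff.2 hz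
  have key : ‖z‖ • (dir y - dir z) = (‖z‖ - ‖y‖) • dir y + (y - z) := by
    rw [smul_sub, norm_smul_dir, sub_smul, norm_smul_dir]; abel
  rw [le_div_iff₀' hz', ← abs_of_pos hz', ← Real.norm_eq_abs, ← norm_smul, key]
  calc _ ≤ ‖(‖z‖ - ‖y‖) • dir y‖ + ‖y - z‖ := norm_add_le _ _
    _ ≤ ‖y - z‖ * 1 + ‖y - z‖ := by
      rw [norm_smul, norm_sub_rev y z]
      gcongr
      · exact abs_norm_sub_norm_le z y
      · exact norm_dir_le y
    _ = _ := by ring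

theorem contDiffAt_dir {y : Vec d} (hy : y ≠ 0) {n : WithTop ℕ∞} : ContDiffAt ℝ n dir y :=
  ((contDiffAt_norm ℝ hy).inv (norm_ne_zero_iff.2 hy)).smul contDiffAt_id

/-- The derivative of `dir` at `y`. -/
def derivDir (y : Vec d) : Vec d →L[ℝ] Vec d := ‖y‖⁻¹ • proj (dir y)

theorem hasStrictFDerivAt_dir {y : Vec d} (hy : y ≠ 0) : HasStrictFDerivAt dir (derivDir y) y := by
  have hy' : ‖y‖ ≠ 0 := norm_ne_zero_iff.2 hy
  suffices h : HasFDerivAt dir (derivDir y) y by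
    have := (contDiffAt_dir hy (n := 1)).hasStrictFDerivAt one_ne_zero
    rwa [h.fderiv] at this
  have h1 : HasFDerivAt (fun x : Vec d => ‖x‖) (innerSL ℝ (dir y)) y := by
    have := ((hasStrictFDerivAt_norm_sq y).hasFDerivAt).sqrt (by positivity)
    simp only [Real.sqrt_sq (norm_nonneg _)] at this
    refine this.congr_fderiv ?_
    ext h
    simp [dir]
    field_simp
  have h2 := (hasDerivAt_inv hy').comp_hasFDerivAt y h1
  refine (h2.smul (hasFDerivAt_id y)).congr_fderiv ?_
  ext1 h
  simp [derivDir, proj_apply, dir, inner_smul_left, smul_smul, sub_eq_add_neg]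
  congr 1
  field_simp

theorem fderiv_dir {y : Vec d} (hy : y ≠ 0) : fderiv ℝ dir y = derivDir y :=
  (hasStrictFDerivAt_dir hy).hasFDerivAt.fderiv

theorem norm_derivDir_le {y : Vec d} {m : ℝ} (hm : 0 < m) (hy : m ≤ ‖y‖) :
    ‖derivDir y‖ ≤ m⁻¹ := by
  have hy0 : y ≠ 0 := norm_pos_iff.1 (hm.trans_le hy)
  rw [derivDir, norm_smul, norm_inv, norm_norm]
  calc _ ≤ m⁻¹ * 1 := by
        gcongr
        exact norm_proj_le (norm_dir hy0)
    _ = _ := mul_one _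

theorem norm_derivDir_sub_le {y z : Vec d} {m : ℝ} (hm : 0 < m) (hy : m ≤ ‖y‖) (hz : m ≤ ‖z‖) :
    ‖derivDir y - derivDir z‖ ≤ 5 * ‖y - z‖ * (m⁻¹) ^ 2 := by
  have hy0 : y ≠ 0 := norm_pos_iff.1 (hm.trans_le hy)
  have hz0 : z ≠ 0 := norm_pos_iff.1 (hm.trans_le hz)
  have hyp := norm_pos_iff.2 hy0
  have hzp := norm_pos_iff.2 hz0
  have key : derivDir y - derivDir z =
      (‖y‖⁻¹ - ‖z‖⁻¹) • proj (dir y) + ‖z‖⁻¹ • (proj (dir y) - proj (dir z)) := by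
    rw [derivDir, derivDir]; module
  have h1 : ‖‖y‖⁻¹ - ‖z‖⁻¹‖ ≤ ‖y - z‖ * (m⁻¹) ^ 2 := by
    have : ‖y‖⁻¹ - ‖z‖⁻¹ = (‖z‖ - ‖y‖) * (‖y‖⁻¹ * ‖z‖⁻¹) := by field_simp
    rw [this, norm_mul, norm_sub_rev y z, sq]
    gcongr
    · exact abs_norm_sub_norm_le z y
    · rw [norm_mul, norm_inv, norm_inv, norm_norm, norm_norm]
      gcongr
  rw [key]
  calc _ ≤ ‖‖y‖⁻¹ - ‖z‖⁻¹‖ * ‖proj (dir y)‖ + ‖z‖⁻¹ * ‖proj (dir y) - proj (dir z)‖ := by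
        refine (norm_add_le _ _).trans_eq ?_
        rw [norm_smul, norm_smul, norm_inv, norm_norm]
    _ ≤ (‖y - z‖ * (m⁻¹) ^ 2) * 1 + m⁻¹ * (2 * (2 * ‖y - z‖ / m)) := by
        gcongr
        · exact norm_proj_le (norm_dir hy0)
        · refine (norm_proj_sub_proj_le (norm_dir hy0) (norm_dir hz0)).trans ?_
          gcongr
          refine (norm_dir_sub_dir_le y hz0).trans ?_
          gcongr
    _ = _ := by field_simp; ring

/-- Hypotheses on a perturbation `b` of the specular reflection off a ball in direction `e`, at
scale `σ`, with `L` bounding all quantities involved. -/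
structure Perturbation (e : Vec d) (b : Vec d → Vec d) (m L σ : ℝ) : Prop where
  norm_e : ‖e‖ = 1
  m_pos : 0 < m
  σ_pos : 0 < σ
  inv_le : m⁻¹ ≤ L
  two_le : 2 ≤ L
  contDiffOn : ContDiffOn ℝ 1 b (ball e m)
  bound : ∀ x ∈ ball e m, ‖b x‖ + 1 ≤ L
  norm_fderiv_le : ∀ x ∈ ball e m, ‖fderiv ℝ b x‖ ≤ L
  small : 1000 * L ^ 4 * σ ≤ 1

/-- The incoming direction, as a function of the outgoing direction `u` and of an approximation
`v` of the incoming direction itself. -/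
def incoming (e : Vec d) (b : Vec d → Vec d) (σ : ℝ) (u v : Vec d) : Vec d :=
  dir (e + σ • (dir (u - v) - b v))

namespace Perturbation

variable {e : Vec d} {b : Vec d → Vec d} {m L σ : ℝ}

theorem small_one (h : Perturbation e b m L σ) : 1000 * L * σ ≤ 1 := by
  have := h.two_le; have := h.σ_pos
  have : L ≤ L ^ 4 := le_self_pow₀ (by linarith) (by norm_num)
  nlinarith [h.small]

theorem small_two (h : Perturbation e b m L σ) : 1000 * L ^ 2 * σ ≤ 1 := by
  have := h.two_le; have := h.σ_pos
  have : L ^ 2 ≤ L ^ 4 := pow_le_pow_right₀ (by linarith) (by norm_num)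
  nlinarith [h.small]

theorem small_m (h : Perturbation e b m L σ) : 1000 * (L * σ) ≤ m := by
  have h0 := h.small_two
  have h1 := h.inv_le
  have hm := h.m_pos
  have hL := h.two_le
  have h2 : 1 ≤ m * L := by
    have := mul_le_mul_of_nonneg_left h1 hm.le
    rwa [mul_inv_cancel₀ hm.ne'] at this
  have h3 : 0 ≤ 1000 * (L * σ) := by have := h.σ_pos; positivity
  calc 1000 * (L * σ) ≤ (m * L) * (1000 * (L * σ)) := le_mul_of_one_le_left h3 h2
    _ = m * (1000 * L ^ 2 * σ) := by ring
    _ ≤ m := mul_le_of_le_one_right hm.le h0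

theorem norm_offset_le (h : Perturbation e b m L σ) (u : Vec d) {v : Vec d} (hv : v ∈ ball e m) :
    ‖σ • (dir (u - v) - b v)‖ ≤ L * σ := by
  rw [norm_smul, Real.norm_of_nonneg h.σ_pos.le, mul_comm]
  have := h.σ_pos
  gcongr
  linarith [norm_sub_le (dir (u - v)) (b v), norm_dir_le (u - v), h.bound v hv]

theorem half_le (h : Perturbation e b m L σ) {w : Vec d} (hw : ‖w‖ ≤ L * σ) :
    1 / 2 ≤ ‖e + w‖ := by
  have := norm_sub_norm_le e (-w)
  rw [sub_neg_eq_add, norm_neg, h.norm_e] at this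
  linarith [h.small_one]

theorem incoming_arg_ne_zero (h : Perturbation e b m L σ) (u : Vec d) {v : Vec d}
    (hv : v ∈ ball e m) : e + σ • (dir (u - v) - b v) ≠ 0 := by
  have := h.half_le (h.norm_offset_le u hv)
  exact norm_pos_iff.1 (by linarith)

theorem norm_incoming (h : Perturbation e b m L σ) (u : Vec d) {v : Vec d}
    (hv : v ∈ ball e m) : ‖incoming e b σ u v‖ = 1 :=
  norm_dir (h.incoming_arg_ne_zero u hv)

theorem e_ne_zero (h : Perturbation e b m L σ) : e ≠ 0 :=
  norm_pos_iff.1 (by rw [h.norm_e]; exact one_pos)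

theorem norm_incoming_sub_le (h : Perturbation e b m L σ) (u : Vec d) {v : Vec d}
    (hv : v ∈ ball e m) : ‖incoming e b σ u v - e‖ ≤ 2 * (L * σ) := by
  have := norm_dir_sub_dir_le (e + σ • (dir (u - v) - b v)) h.e_ne_zero
  rw [dir_of_norm_eq_one h.norm_e, h.norm_e, add_sub_cancel_left, div_one] at this
  refine this.trans ?_
  gcongr
  exact h.norm_offset_le u hv

theorem le_norm_sub (_h : Perturbation e b m L σ) {u v : Vec d} (hu : 2 * m < ‖u - e‖)
    (hv : v ∈ ball e m) : m ≤ ‖u - v‖ := by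
  rw [mem_ball, dist_eq_norm] at hv
  have := norm_sub_le_norm_sub_add_norm_sub u v e
  linarith

theorem norm_dir_sub_le (h : Perturbation e b m L σ) (y : Vec d) {z : Vec d} (hz : m ≤ ‖z‖) :
    ‖dir y - dir z‖ ≤ 2 * L * ‖y - z‖ := by
  have hz0 := h.m_pos.trans_le hz
  refine (norm_dir_sub_dir_le y (norm_pos_iff.1 hz0)).trans ?_
  have : ‖z‖⁻¹ ≤ L := (inv_anti₀ h.m_pos hz).trans h.inv_le
  calc 2 * ‖y - z‖ / ‖z‖ = 2 * ‖y - z‖ * ‖z‖⁻¹ := div_eq_mul_inv _ _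
    _ ≤ 2 * ‖y - z‖ * L := by gcongr
    _ = _ := by ring

theorem differentiableAt (h : Perturbation e b m L σ) {v : Vec d} (hv : v ∈ ball e m) :
    DifferentiableAt ℝ b v :=
  (h.contDiffOn.contDiffAt (isOpen_ball.mem_nhds hv)).differentiableAt one_ne_zero

theorem norm_sub_le (h : Perturbation e b m L σ) {v w : Vec d} (hv : v ∈ ball e m)
    (hw : w ∈ ball e m) : ‖b v - b w‖ ≤ L * ‖v - w‖ :=
  (convex_ball e m).norm_image_sub_le_of_norm_fderiv_le (fun _ hx => h.differentiableAt hx)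
    h.norm_fderiv_le hw hv

theorem norm_incoming_sub_incoming_le (h : Perturbation e b m L σ) {u v u' v' : Vec d}
    (hu' : 2 * m < ‖u' - e‖) (hv : v ∈ ball e m) (hv' : v' ∈ ball e m) :
    ‖incoming e b σ u v - incoming e b σ u' v'‖ ≤
      8 * L * σ * ‖u - u'‖ + 12 * L * σ * ‖v - v'‖ := by
  have hσ := h.σ_pos
  have hL := h.two_le
  set z := e + σ • (dir (u' - v') - b v')
  have hz : 1 / 2 ≤ ‖z‖ := h.half_le (h.norm_offset_le u' hv')
  have hz0 : z ≠ 0 := h.incoming_arg_ne_zero u' hv'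
  have h1 : ‖dir (u - v) - dir (u' - v')‖ ≤ 2 * L * (‖u - u'‖ + ‖v - v'‖) := by
    refine (h.norm_dir_sub_le _ (h.le_norm_sub hu' hv')).trans ?_
    gcongr
    rw [show u - v - (u' - v') = (u - u') - (v - v') by abel]
    exact _root_.norm_sub_le _ _
  have h2 := h.norm_sub_le hv hv'
  calc ‖incoming e b σ u v - incoming e b σ u' v'‖
      ≤ 2 * ‖(e + σ • (dir (u - v) - b v)) - z‖ / ‖z‖ := norm_dir_sub_dir_le _ hz0
    _ = 2 * ‖σ • ((dir (u - v) - dir (u' - v')) - (b v - b v'))‖ / ‖z‖ := by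
      congr 3; simp only [z]; module
    _ ≤ 2 * (σ * (2 * L * (‖u - u'‖ + ‖v - v'‖) + L * ‖v - v'‖)) / (1 / 2) := by
      gcongr
      rw [norm_smul, Real.norm_of_nonneg hσ.le]
      gcongr
      exact (_root_.norm_sub_le _ _).trans (add_le_add h1 h2)
    _ = _ := by ring

theorem exists_incoming_eq (h : Perturbation e b m L σ) {u : Vec d} (hu : 2 * m < ‖u - e‖) :
    ∃ v ∈ ball e m, incoming e b σ u v = v := by
  have hm := h.m_pos
  have hsub : closedBall e (m / 2) ⊆ ball e m := closedBall_subset_ball (by linarith)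
  have hmaps : MapsTo (incoming e b σ u) (closedBall e (m / 2)) (closedBall e (m / 2)) := by
    intro v hv
    rw [mem_closedBall, dist_eq_norm]
    linarith [h.norm_incoming_sub_le u (hsub hv), h.small_m]
  have hcontr : ContractingWith (1 / 2) (hmaps.restrict (incoming e b σ u) _ _) := by
    refine ⟨by norm_num, LipschitzWith.of_dist_le_mul fun v w => ?_⟩
    have := h.norm_incoming_sub_incoming_le (u := u) hu (hsub v.2) (hsub w.2)
    rw [sub_self, norm_zero, mul_zero, zero_add] at this
    rw [Subtype.dist_eq, Subtype.dist_eq, dist_eq_norm, dist_eq_norm]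
    refine this.trans ?_
    push_cast
    gcongr
    linarith [h.small_one]
  obtain ⟨v, hv, hfix, -⟩ := hcontr.exists_fixedPoint' isClosed_closedBall.isComplete hmaps
    (mem_closedBall_self (by linarith)) (edist_ne_top _ _)
  exact ⟨v, hsub hv, hfix⟩

theorem incoming_fixed_sub_le (h : Perturbation e b m L σ) {u u' v v' : Vec d}
    (hu' : 2 * m < ‖u' - e‖) (hv : v ∈ ball e m) (hv' : v' ∈ ball e m)
    (hfix : incoming e b σ u v = v) (hfix' : incoming e b σ u' v' = v') :
    ‖v - v'‖ ≤ ‖u - u'‖ := by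
  have := h.norm_incoming_sub_incoming_le (u := u) hu' hv hv'
  rw [hfix, hfix'] at this
  nlinarith [h.small_one, norm_nonneg (u - u'), norm_nonneg (v - v')]

/-- The incoming direction solving the fixed point equation for the outgoing direction `u`. -/
def solution (e : Vec d) (b : Vec d → Vec d) (m σ : ℝ) (u : Vec d) : Vec d :=
  Classical.epsilon fun v => v ∈ ball e m ∧ incoming e b σ u v = v

theorem solution_spec (h : Perturbation e b m L σ) {u : Vec d} (hu : 2 * m < ‖u - e‖) :
    solution e b m σ u ∈ ball e m ∧
      incoming e b σ u (solution e b m σ u) = solution e b m σ u :=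
  Classical.epsilon_spec (h.exists_incoming_eq hu)

theorem eq_solution (h : Perturbation e b m L σ) {u v : Vec d} (hu : 2 * m < ‖u - e‖)
    (hv : v ∈ ball e m) (hfix : incoming e b σ u v = v) : v = solution e b m σ u := by
  obtain ⟨h1, h2⟩ := h.solution_spec hu
  have := h.incoming_fixed_sub_le hu hv h1 hfix h2
  rw [sub_self, norm_zero] at this
  exact sub_eq_zero.1 (norm_le_zero_iff.1 this)

theorem norm_solution (h : Perturbation e b m L σ) {u : Vec d} (hu : 2 * m < ‖u - e‖) :
    ‖solution e b m σ u‖ = 1 := by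
  obtain ⟨h1, h2⟩ := h.solution_spec hu
  rw [← h2]
  exact h.norm_incoming u h1

theorem norm_solution_sub_le (h : Perturbation e b m L σ) {u : Vec d} (hu : 2 * m < ‖u - e‖) :
    ‖solution e b m σ u - e‖ ≤ 2 * (L * σ) := by
  obtain ⟨h1, h2⟩ := h.solution_spec hu
  have := h.norm_incoming_sub_le u h1
  rwa [h2] at this

theorem isOpen_outgoing (e : Vec d) (m : ℝ) : IsOpen {u : Vec d | 2 * m < ‖u - e‖} :=
  isOpen_lt continuous_const (by fun_prop)

theorem continuousAt_solution (h : Perturbation e b m L σ) {u : Vec d} (hu : 2 * m < ‖u - e‖) :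
    ContinuousAt (solution e b m σ) u := by
  have hlip : LipschitzOnWith 1 (solution e b m σ) {u : Vec d | 2 * m < ‖u - e‖} := by
    refine LipschitzOnWith.of_dist_le_mul fun u hu u' hu' => ?_
    obtain ⟨h1, h2⟩ := h.solution_spec hu
    obtain ⟨h1', h2'⟩ := h.solution_spec hu'
    rw [NNReal.coe_one, one_mul, dist_eq_norm, dist_eq_norm]
    exact h.incoming_fixed_sub_le hu' h1 h1' h2 h2'
  exact hlip.continuousOn.continuousAt ((isOpen_outgoing e m).mem_nhds hu)

theorem contDiffAt_incoming (h : Perturbation e b m L σ) {u v : Vec d}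
    (hu : 2 * m < ‖u - e‖) (hv : v ∈ ball e m) :
    ContDiffAt ℝ 1 (fun p : Vec d × Vec d => incoming e b σ p.1 p.2) (u, v) := by
  have huv : u - v ≠ 0 := norm_pos_iff.1 (h.m_pos.trans_le (h.le_norm_sub hu hv))
  have h1 : ContDiffAt ℝ 1 (fun p : Vec d × Vec d => dir (p.1 - p.2)) (u, v) :=
    ContDiffAt.comp (u, v) (g := dir) (contDiffAt_dir huv) (contDiffAt_fst.sub contDiffAt_snd)
  have h2 : ContDiffAt ℝ 1 (fun p : Vec d × Vec d => b p.2) (u, v) :=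
    ContDiffAt.comp (u, v) (g := b) (h.contDiffOn.contDiffAt (isOpen_ball.mem_nhds hv))
      contDiffAt_snd
  exact ContDiffAt.comp (u, v) (g := dir) (contDiffAt_dir (h.incoming_arg_ne_zero u hv))
    (contDiffAt_const.add ((h1.sub h2).const_smul σ))

theorem contDiffOn_solution (h : Perturbation e b m L σ) :
    ContDiffOn ℝ 1 (solution e b m σ) {u | 2 * m < ‖u - e‖} := by
  intro u hu
  refine ContDiffAt.contDiffWithinAt ?_
  obtain ⟨h1, h2⟩ := h.solution_spec hu
  set v := solution e b m σ u with hvdef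
  have hinc := h.contDiffAt_incoming hu h1
  set f : Vec d × Vec d → Vec d := fun p => p.2 - incoming e b σ p.1 p.2 with hf
  have hcd : ContDiffAt ℝ 1 f (u, v) := contDiffAt_snd.sub hinc
  set A : Vec d →L[ℝ] Vec d := fderiv ℝ (incoming e b σ u) v with hA
  have hA_le : ‖A‖ ≤ 1 / 2 := by
    refine norm_fderiv_le_of_lip' ℝ (by norm_num) ?_
    filter_upwards [isOpen_ball.mem_nhds h1] with w hw
    have := h.norm_incoming_sub_incoming_le (u := u) hu hw h1
    rw [sub_self, norm_zero, mul_zero, zero_add] at this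
    refine this.trans ?_
    gcongr
    linarith [h.small_one]
  have hpart : fderiv ℝ f (u, v) ∘L .inr ℝ (Vec d) (Vec d) = 1 - A := by
    have e1 : HasFDerivAt (fun w => f (u, w)) (fderiv ℝ f (u, v) ∘L .inr ℝ (Vec d) (Vec d)) v :=
      (hcd.differentiableAt one_ne_zero).hasFDerivAt.comp v (hasFDerivAt_prodMk_right u v)
    have e2 : DifferentiableAt ℝ (incoming e b σ u) v :=
      (hinc.differentiableAt one_ne_zero).comp v
        (hasFDerivAt_prodMk_right (𝕜 := ℝ) u v).differentiableAt
    exact e1.unique ((hasFDerivAt_id v).sub e2.hasFDerivAt)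
  have hinv : (fderiv ℝ f (u, v) ∘L .inr ℝ (Vec d) (Vec d)).IsInvertible := by
    rw [hpart]
    obtain ⟨w, hw⟩ := isUnit_one_sub_of_norm_lt_one (x := A) (by linarith)
    exact ⟨ContinuousLinearEquiv.unitsEquiv ℝ (Vec d) w, by rw [← hw]; rfl⟩
  have hev := hcd.eventually_apply_eq_iff_implicitFunction one_ne_zero hinv
  have hcont : Tendsto (fun u' => (u', solution e b m σ u')) (𝓝 u) (𝓝 (u, v)) :=
    tendsto_id.prodMk_nhds (h.continuousAt_solution hu)
  have hopen := (isOpen_outgoing e m).mem_nhds hu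
  refine (hcd.contDiffAt_implicitFunction one_ne_zero hinv).congr_of_eventuallyEq ?_
  filter_upwards [hcont.eventually hev, hopen] with u' hu' hu'2
  refine (hu'.1 ?_).symm
  simp only [hf, (h.solution_spec hu'2).2, h2, sub_self]

/-- The location on the unit sphere at which reflection produces the outgoing direction `u`. -/
def location (e : Vec d) (b : Vec d → Vec d) (m σ : ℝ) (u : Vec d) : Vec d :=
  dir (u - solution e b m σ u)

theorem differentiableAt_solution (h : Perturbation e b m L σ) {u : Vec d}
    (hu : 2 * m < ‖u - e‖) : DifferentiableAt ℝ (solution e b m σ) u :=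
  (h.contDiffOn_solution.contDiffAt ((isOpen_outgoing e m).mem_nhds hu)).differentiableAt
    one_ne_zero

theorem sub_solution_ne_zero (h : Perturbation e b m L σ) {u : Vec d} (hu : 2 * m < ‖u - e‖) :
    u - solution e b m σ u ≠ 0 :=
  norm_pos_iff.1 (h.m_pos.trans_le (h.le_norm_sub hu (h.solution_spec hu).1))

theorem contDiffOn_location (h : Perturbation e b m L σ) :
    ContDiffOn ℝ 1 (location e b m σ) {u | 2 * m < ‖u - e‖} := by
  intro u hu
  refine ContDiffAt.contDiffWithinAt ?_
  have h1 := h.contDiffOn_solution.contDiffAt ((isOpen_outgoing e m).mem_nhds hu)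
  exact ContDiffAt.comp u (g := dir) (contDiffAt_dir (h.sub_solution_ne_zero hu))
    (contDiffAt_id.sub h1)

/-- The derivative of `location` in terms of the derivative of `solution`. -/
theorem hasFDerivAt_location (h : Perturbation e b m L σ) {u : Vec d} (hu : 2 * m < ‖u - e‖) :
    HasFDerivAt (location e b m σ)
      (derivDir (u - solution e b m σ u) ∘L
        (ContinuousLinearMap.id ℝ (Vec d) - fderiv ℝ (solution e b m σ) u)) u :=
  HasFDerivAt.comp u (g := dir) (hasStrictFDerivAt_dir (h.sub_solution_ne_zero hu)).hasFDerivAt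
    ((hasFDerivAt_id u).sub (h.differentiableAt_solution hu).hasFDerivAt)

theorem fderiv_solution_eq (h : Perturbation e b m L σ) {u : Vec d} (hu : 2 * m < ‖u - e‖) :
    fderiv ℝ (solution e b m σ) u =
      σ • (derivDir (e + σ • (location e b m σ u - b (solution e b m σ u))) ∘L
        (fderiv ℝ (location e b m σ) u -
          fderiv ℝ b (solution e b m σ u) ∘L fderiv ℝ (solution e b m σ) u)) := by
  obtain ⟨h1, h2⟩ := h.solution_spec hu
  have hb := (h.differentiableAt h1).hasFDerivAt.comp u (h.differentiableAt_solution hu).hasFDerivAt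
  have hloc := (h.hasFDerivAt_location hu)
  rw [← hloc.fderiv] at hloc
  have hin := ((hloc.sub hb).const_smul σ).const_add e
  have hz := h.incoming_arg_ne_zero u h1
  have hcomp := HasFDerivAt.comp u (g := dir) (hasStrictFDerivAt_dir hz).hasFDerivAt hin
  rw [ContinuousLinearMap.comp_smul] at hcomp
  refine HasFDerivAt.fderiv (hcomp.congr_of_eventuallyEq ?_)
  filter_upwards [(isOpen_outgoing e m).mem_nhds hu] with w hw
  exact (h.solution_spec hw).2.symm

theorem norm_derivDir_sub_solution_le (h : Perturbation e b m L σ) {u : Vec d}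
    (hu : 2 * m < ‖u - e‖) : ‖derivDir (u - solution e b m σ u)‖ ≤ L :=
  (norm_derivDir_le h.m_pos (h.le_norm_sub hu (h.solution_spec hu).1)).trans h.inv_le

theorem norm_fderiv_location_le (h : Perturbation e b m L σ) {u : Vec d}
    (hu : 2 * m < ‖u - e‖) :
    ‖fderiv ℝ (location e b m σ) u‖ ≤ L * (1 + ‖fderiv ℝ (solution e b m σ) u‖) := by
  have hL := h.two_le
  rw [(h.hasFDerivAt_location hu).fderiv]
  refine (ContinuousLinearMap.opNorm_comp_le _ _).trans ?_
  gcongr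
  · exact h.norm_derivDir_sub_solution_le hu
  · refine (_root_.norm_sub_le _ _).trans ?_
    gcongr
    exact ContinuousLinearMap.norm_id_le

theorem norm_inner_deriv_le (h : Perturbation e b m L σ) {u : Vec d} (hu : 2 * m < ‖u - e‖) :
    ‖fderiv ℝ (location e b m σ) u -
      fderiv ℝ b (solution e b m σ u) ∘L fderiv ℝ (solution e b m σ) u‖ ≤
      L * (1 + 2 * ‖fderiv ℝ (solution e b m σ) u‖) := by
  obtain ⟨h1, h2⟩ := h.solution_spec hu
  calc _ ≤ L * (1 + ‖fderiv ℝ (solution e b m σ) u‖) + L * ‖fderiv ℝ (solution e b m σ) u‖ := by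
        refine (_root_.norm_sub_le _ _).trans
          (add_le_add (h.norm_fderiv_location_le hu)
            ((ContinuousLinearMap.opNorm_comp_le _ _).trans ?_))
        gcongr
        exact h.norm_fderiv_le _ h1
    _ = _ := by ring

theorem norm_fderiv_solution_le (h : Perturbation e b m L σ) {u : Vec d}
    (hu : 2 * m < ‖u - e‖) : ‖fderiv ℝ (solution e b m σ) u‖ ≤ 4 * L * σ := by
  obtain ⟨h1, h2⟩ := h.solution_spec hu
  have hσ := h.σ_pos
  have hL := h.two_le
  set q := ‖fderiv ℝ (solution e b m σ) u‖ with hq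
  have hq0 : 0 ≤ q := norm_nonneg _
  have : q ≤ σ * (2 * (L * (1 + 2 * q))) := by
    refine (congrArg norm (h.fderiv_solution_eq hu)).trans_le ?_
    rw [norm_smul, Real.norm_of_nonneg hσ.le]
    gcongr
    refine (ContinuousLinearMap.opNorm_comp_le _ _).trans ?_
    gcongr
    · have := norm_derivDir_le (by norm_num) (h.half_le (h.norm_offset_le u h1))
      norm_num at this
      exact this
    · exact h.norm_inner_deriv_le hu
  nlinarith [h.small_one]

theorem norm_fderiv_location_sub_le (h : Perturbation e b m L σ) {u : Vec d}
    (hu : 2 * m < ‖u - e‖) :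
    ‖fderiv ℝ (location e b m σ) u - derivDir (u - e)‖ ≤ 14 * L ^ 3 * σ := by
  have hσ := h.σ_pos
  have hL := h.two_le
  have hm := h.m_pos
  set v := solution e b m σ u
  have key : fderiv ℝ (location e b m σ) u - derivDir (u - e) =
      (derivDir (u - v) - derivDir (u - e)) -
        derivDir (u - v) ∘L fderiv ℝ (solution e b m σ) u := by
    rw [(h.hasFDerivAt_location hu).fderiv, ContinuousLinearMap.comp_sub,
      ContinuousLinearMap.comp_id]
    abel
  have h1 : ‖derivDir (u - v) - derivDir (u - e)‖ ≤ 5 * (2 * (L * σ)) * L ^ 2 := by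
    refine (norm_derivDir_sub_le hm (h.le_norm_sub hu (h.solution_spec hu).1)
      (by linarith : m ≤ ‖u - e‖)).trans ?_
    gcongr
    · rw [sub_sub_sub_cancel_left, norm_sub_rev]
      exact h.norm_solution_sub_le hu
    · exact h.inv_le
  have h2 : ‖derivDir (u - v) ∘L fderiv ℝ (solution e b m σ) u‖ ≤ L * (4 * L * σ) := by
    refine (ContinuousLinearMap.opNorm_comp_le _ _).trans ?_
    gcongr
    · exact h.norm_derivDir_sub_solution_le hu
    · exact h.norm_fderiv_solution_le hu
  rw [key]
  refine (_root_.norm_sub_le _ _).trans ((add_le_add h1 h2).trans ?_)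
  have : 0 ≤ L ^ 2 * σ * (L - 1) := mul_nonneg (by positivity) (by linarith)
  nlinarith

theorem norm_inv_smul_fderiv_solution_sub_le (h : Perturbation e b m L σ) {u : Vec d}
    (hu : 2 * m < ‖u - e‖) :
    ‖σ⁻¹ • fderiv ℝ (solution e b m σ) u - proj e ∘L derivDir (u - e)‖ ≤ 58 * L ^ 3 * σ := by
  obtain ⟨h1, h2⟩ := h.solution_spec hu
  have hσ := h.σ_pos
  have hL := h.two_le
  set v := solution e b m σ u
  set T := fderiv ℝ (solution e b m σ) u with hT
  set B := fderiv ℝ (location e b m σ) u with hB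
  set z := e + σ • (location e b m σ u - b v) with hz
  have hq : ‖T‖ ≤ 4 * L * σ := h.norm_fderiv_solution_le hu
  have hproj : derivDir e = proj e := by
    rw [derivDir, h.norm_e, inv_one, one_smul, dir_of_norm_eq_one h.norm_e]
  have key : σ⁻¹ • T - proj e ∘L derivDir (u - e) =
      (derivDir z - derivDir e) ∘L (B - fderiv ℝ b v ∘L T) +
        proj e ∘L ((B - derivDir (u - e)) - fderiv ℝ b v ∘L T) := by
    have hTz : σ⁻¹ • T = derivDir z ∘L (B - fderiv ℝ b v ∘L T) := by
      refine (congrArg (σ⁻¹ • ·) (h.fderiv_solution_eq hu)).trans ?_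
      exact inv_smul_smul₀ hσ.ne' _
    rw [hTz, hproj]
    ext1 w
    simp only [ContinuousLinearMap.comp_apply, sub_apply, add_apply, map_sub]
    abel
  have hz1 : ‖derivDir z - derivDir e‖ ≤ 5 * (L * σ) * 2 ^ 2 := by
    have hoff : ‖σ • (location e b m σ u - b v)‖ ≤ L * σ := h.norm_offset_le u h1
    have := norm_derivDir_sub_le (m := 1 / 2) (by norm_num) (h.half_le hoff)
      (show 1 / 2 ≤ ‖e‖ by rw [h.norm_e]; norm_num)
    rw [add_sub_cancel_left] at this
    refine this.trans ?_
    rw [one_div, inv_inv]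
    gcongr
  have hbT : ‖fderiv ℝ b v ∘L T‖ ≤ L * (4 * L * σ) := by
    refine (ContinuousLinearMap.opNorm_comp_le _ _).trans ?_
    gcongr
    exact h.norm_fderiv_le _ h1
  have hfst : ‖(derivDir z - derivDir e) ∘L (B - fderiv ℝ b v ∘L T)‖ ≤
      5 * (L * σ) * 2 ^ 2 * (L * 2) := by
    refine (ContinuousLinearMap.opNorm_comp_le _ _).trans ?_
    gcongr
    refine (h.norm_inner_deriv_le hu).trans ?_
    gcongr
    linarith [h.small_one]
  have hsnd : ‖proj e ∘L ((B - derivDir (u - e)) - fderiv ℝ b v ∘L T)‖ ≤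
      1 * (14 * L ^ 3 * σ + L * (4 * L * σ)) := by
    refine (ContinuousLinearMap.opNorm_comp_le _ _).trans ?_
    gcongr
    · exact norm_proj_le h.norm_e
    · exact (_root_.norm_sub_le _ _).trans (add_le_add (h.norm_fderiv_location_sub_le hu) hbT)
  rw [key]
  refine (norm_add_le _ _).trans ((add_le_add hfst hsnd).trans ?_)
  have : 0 ≤ L ^ 2 * σ * (L - 1) := mul_nonneg (by positivity) (by linarith)
  nlinarith

end Perturbation

section Scatter

variable {e : Vec d} {m : ℝ}

/-- The point of the incoming hemisphere of the unit sphere lying over `y`. -/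
def hemi (e y : Vec d) : Vec d := proj e y - Real.sqrt (1 - ‖proj e y‖ ^ 2) • e

theorem proj_proj (he : ‖e‖ = 1) (y : Vec d) : proj e (proj e y) = proj e y := by
  simp [proj_apply, inner_sub_right, inner_smul_right, he]

theorem inner_proj_right (he : ‖e‖ = 1) (y : Vec d) : ⟪e, proj e y⟫ = 0 := by
  simp [proj_apply, inner_sub_right, inner_smul_right, he]

theorem proj_self (he : ‖e‖ = 1) : proj e e = 0 := by simp [proj_apply, he]

theorem inner_hemi (he : ‖e‖ = 1) (y : Vec d) :
    ⟪e, hemi e y⟫ = -Real.sqrt (1 - ‖proj e y‖ ^ 2) := by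
  simp [hemi, inner_sub_right, inner_smul_right, he, inner_proj_right he]

theorem proj_hemi (he : ‖e‖ = 1) (y : Vec d) : proj e (hemi e y) = proj e y := by
  rw [hemi, map_sub, map_smul, proj_self he, proj_proj he, smul_zero, sub_zero]

theorem norm_hemi (he : ‖e‖ = 1) {y : Vec d} (hy : ‖proj e y‖ ≤ 1) : ‖hemi e y‖ = 1 := by
  have h1 : 0 ≤ 1 - ‖proj e y‖ ^ 2 := by nlinarith [norm_nonneg (proj e y)]
  have : ‖hemi e y‖ ^ 2 = 1 := by
    rw [hemi, norm_sub_sq_real, inner_smul_right, real_inner_comm, inner_proj_right he, norm_smul,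
      he, mul_one, Real.norm_eq_abs, sq_abs, Real.sq_sqrt h1]
    ring
  nlinarith [norm_nonneg (hemi e y)]

/-- The outgoing direction of the ray of incoming direction `e` hitting the unit sphere over `y`. -/
def outgoing (e y : Vec d) : Vec d :=
  e + (2 * Real.sqrt (1 - ‖proj e y‖ ^ 2)) • hemi e y

theorem scatterDir_proj {s : Vec d} (hs : s ≠ 0) (y : Vec d) :
    scatterDir s (proj (dir s) y) = outgoing (dir s) y := by
  have h := inner_hemi (norm_dir hs) y
  rw [scatterDir, outgoing]
  change dir s - (2 * ⟪dir s, hemi (dir s) y⟫) • hemi (dir s) y = _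
  rw [h]
  module

theorem outgoing_proj (he : ‖e‖ = 1) (y : Vec d) : outgoing e (proj e y) = outgoing e y := by
  simp only [outgoing, hemi, proj_proj he]

theorem dir_outgoing_sub (he : ‖e‖ = 1) {y : Vec d} (hy : ‖proj e y‖ < 1) :
    dir (outgoing e y - e) = hemi e y := by
  have h1 : 0 < Real.sqrt (1 - ‖proj e y‖ ^ 2) :=
    Real.sqrt_pos.2 (by nlinarith [norm_nonneg (proj e y)])
  rw [outgoing, add_sub_cancel_left, dir_smul (by positivity),
    dir_of_norm_eq_one (norm_hemi he hy.le)]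

theorem norm_outgoing_sub (he : ‖e‖ = 1) {y : Vec d} (hy : ‖proj e y‖ ≤ 1) :
    ‖outgoing e y - e‖ = 2 * Real.sqrt (1 - ‖proj e y‖ ^ 2) := by
  rw [outgoing, add_sub_cancel_left, norm_smul, norm_hemi he hy, mul_one,
    Real.norm_of_nonneg (by positivity)]

theorem outgoing_eq (he : ‖e‖ = 1) {u : Vec d} (hu : ‖u‖ = 1) (hue : u ≠ e) :
    outgoing e (dir (u - e)) = u ∧ ‖proj e (dir (u - e))‖ < 1 := by
  have h0 : u - e ≠ 0 := sub_ne_zero.2 hue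
  have hpos : 0 < ‖u - e‖ := norm_pos_iff.2 h0
  have hsq : ‖u - e‖ ^ 2 = 2 - 2 * ⟪e, u⟫ := by
    rw [norm_sub_sq_real, hu, he, real_inner_comm]; ring
  have hin : ⟪e, dir (u - e)⟫ = -(‖u - e‖ / 2) := by
    rw [dir, inner_smul_right, inner_sub_right, real_inner_self_eq_norm_sq, he]
    field_simp
    linarith
  have hP : ‖proj e (dir (u - e))‖ ^ 2 = 1 - (‖u - e‖ / 2) ^ 2 := by
    rw [proj_apply, norm_sub_sq_real, inner_smul_right, norm_smul, norm_dir h0, he,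
      real_inner_comm e, hin, Real.norm_eq_abs, mul_one, sq_abs]
    ring
  constructor
  · have hr : Real.sqrt (1 - ‖proj e (dir (u - e))‖ ^ 2) = ‖u - e‖ / 2 := by
      rw [hP, sub_sub_cancel, Real.sqrt_sq (by positivity)]
    rw [outgoing, hemi, hr, proj_apply, hin]
    have : dir (u - e) - -(‖u - e‖ / 2) • e - (‖u - e‖ / 2) • e = dir (u - e) := by module
    rw [this, mul_div_cancel₀ _ two_ne_zero, norm_smul_dir]
    abel
  · nlinarith [norm_nonneg (proj e (dir (u - e)))]

theorem exists_hasFDerivAt_hemi (he : ‖e‖ = 1) (hm : 0 < m) {y : Vec d}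
    (hy : m < Real.sqrt (1 - ‖proj e y‖ ^ 2)) :
    ∃ φ : Vec d →L[ℝ] ℝ, ‖φ‖ ≤ m⁻¹ ∧
      HasFDerivAt (fun y => Real.sqrt (1 - ‖proj e y‖ ^ 2)) φ y ∧
      HasFDerivAt (hemi e) (proj e - φ.smulRight e) y := by
  have hpos : 0 < 1 - ‖proj e y‖ ^ 2 := Real.sqrt_pos.1 (hm.trans hy)
  have h1 : HasFDerivAt (fun y => 1 - ‖proj e y‖ ^ 2)
      (-((2 • innerSL ℝ (proj e y)) ∘L proj e)) y :=
    ((hasStrictFDerivAt_norm_sq (proj e y)).hasFDerivAt.comp y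
      (proj e).hasFDerivAt).const_sub 1
  have h2 := h1.sqrt hpos.ne'
  refine ⟨_, ?_, h2, (proj e).hasFDerivAt.sub (h2.smul_const e)⟩
  refine ContinuousLinearMap.opNorm_le_bound _ (by positivity) fun w => ?_
  simp only [smul_apply, neg_apply, ContinuousLinearMap.comp_apply, innerSL_apply_apply,
    smul_eq_mul, norm_mul, norm_neg]
  rw [Real.norm_of_nonneg (by positivity)]
  have hb : ‖(2:ℕ) • ⟪proj e y, proj e w⟫‖ ≤ 2 * ‖w‖ := by
    rw [nsmul_eq_mul, norm_mul]
    push_cast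
    rw [Real.norm_two]
    gcongr
    refine (norm_inner_le_norm _ _).trans ?_
    calc ‖proj e y‖ * ‖proj e w‖ ≤ 1 * (1 * ‖w‖) := by
          gcongr
          · nlinarith [norm_nonneg (proj e y)]
          · exact ((proj e).le_opNorm w).trans (by gcongr; exact norm_proj_le he)
      _ = ‖w‖ := by ring
  calc _ ≤ 1 / (2 * m) * (2 * ‖w‖) := by gcongr
    _ = m⁻¹ * ‖w‖ := by field_simp

theorem norm_proj_lt_one (hm : 0 < m) {y : Vec d} (hy : m < Real.sqrt (1 - ‖proj e y‖ ^ 2)) :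
    ‖proj e y‖ < 1 := by
  have hpos : 0 < 1 - ‖proj e y‖ ^ 2 := Real.sqrt_pos.1 (hm.trans hy)
  nlinarith [norm_nonneg (proj e y)]

theorem lt_norm_outgoing_sub_iff (he : ‖e‖ = 1) {y : Vec d} (hy : ‖proj e y‖ ≤ 1) :
    2 * m < ‖outgoing e y - e‖ ↔ m < Real.sqrt (1 - ‖proj e y‖ ^ 2) := by
  rw [norm_outgoing_sub he hy, mul_lt_mul_iff_right₀ two_pos]

theorem isOpen_disc (e : Vec d) (m : ℝ) :
    IsOpen {y : Vec d | m < Real.sqrt (1 - ‖proj e y‖ ^ 2)} :=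
  isOpen_lt continuous_const (by fun_prop)

theorem contDiffOn_outgoing (hm : 0 < m) :
    ContDiffOn ℝ 1 (outgoing e) {y | m < Real.sqrt (1 - ‖proj e y‖ ^ 2)} := by
  intro y hy
  refine ContDiffAt.contDiffWithinAt ?_
  have hpos : 0 < 1 - ‖proj e y‖ ^ 2 := Real.sqrt_pos.1 (hm.trans hy)
  have h1 : ContDiffAt ℝ 1 (fun y => Real.sqrt (1 - ‖proj e y‖ ^ 2)) y := by
    refine ContDiffAt.sqrt ?_ hpos.ne'
    exact contDiffAt_const.sub ((proj e).contDiff.contDiffAt.norm_sq ℝ)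
  have h2 : ContDiffAt ℝ 1 (hemi e) y :=
    (proj e).contDiff.contDiffAt.sub (h1.smul contDiffAt_const)
  exact contDiffAt_const.add ((contDiffAt_const.mul h1).smul h2)

theorem norm_fderiv_outgoing_le (he : ‖e‖ = 1) (hm : 0 < m) {y : Vec d}
    (hy : m < Real.sqrt (1 - ‖proj e y‖ ^ 2)) : ‖fderiv ℝ (outgoing e) y‖ ≤ 4 * m⁻¹ + 2 := by
  obtain ⟨φ, hφ, h1, h2⟩ := exists_hasFDerivAt_hemi he hm hy
  have hlt := norm_proj_lt_one hm hy
  have h3 := ((h1.const_mul 2).smul h2).const_add e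
  have h3' : fderiv ℝ (outgoing e) y = _ := h3.fderiv
  have hφe : ‖φ.smulRight e‖ ≤ m⁻¹ := by
    rw [ContinuousLinearMap.norm_smulRight_apply, he, mul_one]; exact hφ
  have hs1 : Real.sqrt (1 - ‖proj e y‖ ^ 2) ≤ 1 := by
    rw [Real.sqrt_le_iff]; constructor <;> nlinarith [sq_nonneg ‖proj e y‖]
  rw [h3']
  calc _ ≤ 2 * 1 * (1 + m⁻¹) + 2 * m⁻¹ * 1 := by
        refine (norm_add_le _ _).trans (add_le_add ?_ ?_)
        · rw [norm_smul, Real.norm_of_nonneg (by positivity)]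
          gcongr
          exact (norm_sub_le _ _).trans (add_le_add (norm_proj_le he) hφe)
        · rw [ContinuousLinearMap.norm_smulRight_apply, norm_smul, Real.norm_two,
            norm_hemi he hlt.le]
          gcongr
    _ = _ := by ring

theorem proj_comp_derivDir_comp (he : ‖e‖ = 1) (hm : 0 < m) {y : Vec d}
    (hy : m < Real.sqrt (1 - ‖proj e y‖ ^ 2)) :
    proj e ∘L derivDir (outgoing e y - e) ∘L fderiv ℝ (outgoing e) y = proj e := by
  obtain ⟨φ, -, -, h2⟩ := exists_hasFDerivAt_hemi he hm hy
  have hopen := (isOpen_disc e m).mem_nhds hy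
  have hlt := norm_proj_lt_one hm hy
  have hne : outgoing e y - e ≠ 0 := norm_pos_iff.1 (by
    have := (lt_norm_outgoing_sub_iff he hlt.le).2 hy
    linarith)
  have hout := (((contDiffOn_outgoing hm).contDiffAt hopen).differentiableAt
    one_ne_zero).hasFDerivAt
  have hcomp := HasFDerivAt.comp y (g := dir) (hasStrictFDerivAt_dir hne).hasFDerivAt
    (hout.sub_const e)
  have heq : hemi e =ᶠ[𝓝 y] dir ∘ (fun y => outgoing e y - e) := by
    filter_upwards [hopen] with w hw
    exact (dir_outgoing_sub he (norm_proj_lt_one hm hw)).symm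
  rw [(hcomp.congr_of_eventuallyEq heq).unique h2]
  ext1 w
  simp [proj_proj he, proj_self he]

/-- The map scaling the orthogonal complement of `e` by `t`. -/
def stretch (e : Vec d) (t : ℝ) : Vec d →L[ℝ] Vec d := (innerSL ℝ e).smulRight e + t • proj e

theorem stretch_apply (e : Vec d) (t : ℝ) (y : Vec d) :
    stretch e t y = ⟪e, y⟫ • e + t • proj e y := by
  simp [stretch]

theorem stretch_comp_stretch (he : ‖e‖ = 1) (t t' : ℝ) :
    stretch e t ∘L stretch e t' = stretch e (t * t') := by
  ext1 y
  simp [stretch_apply, inner_add_right, inner_smul_right, he, inner_proj_right he, proj_proj he,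
    proj_self he, smul_smul]

theorem det_stretch_ne_zero (he : ‖e‖ = 1) {t : ℝ} (ht : t ≠ 0) : (stretch e t).det ≠ 0 := by
  have h1 : stretch e t ∘L stretch e t⁻¹ = 1 := by
    rw [stretch_comp_stretch he, mul_inv_cancel₀ ht]
    ext1 y
    simp [stretch_apply, proj_apply]
  have h2 : (stretch e t).det * (stretch e t⁻¹).det = 1 := by
    have h3 := congrArg ContinuousLinearMap.det h1
    rw [ContinuousLinearMap.det, ContinuousLinearMap.toLinearMap_comp, LinearMap.det_comp] at h3
    exact h3.trans LinearMap.det_id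
  exact left_ne_zero_of_mul_eq_one h2

end Scatter

namespace Perturbation

variable {e : Vec d} {b : Vec d → Vec d} {m L σ : ℝ}

/-- The linear distortion, relative to the unperturbed and unscaled situation, of the map
sending a point of the disc to the corresponding incoming direction. -/
def distortion (e : Vec d) (b : Vec d → Vec d) (m σ : ℝ) (x : Vec d) : Vec d →L[ℝ] Vec d :=
  (innerSL ℝ e).smulRight (solution e b m σ (outgoing e x)) +
    σ⁻¹ • (fderiv ℝ (solution e b m σ) (outgoing e x) ∘L fderiv ℝ (outgoing e) x ∘L proj e)

theorem norm_distortion_sub_one_le (h : Perturbation e b m L σ) {y : Vec d}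
    (hy : m < Real.sqrt (1 - ‖proj e y‖ ^ 2)) :
    ‖distortion e b m σ y - 1‖ ≤ 500 * L ^ 4 * σ := by
  have he := h.norm_e
  have hL := h.two_le
  have hσ := h.σ_pos
  have hu := (lt_norm_outgoing_sub_iff he (norm_proj_lt_one h.m_pos hy).le).2 hy
  set u := outgoing e y
  set T := fderiv ℝ (solution e b m σ) u
  set S := fderiv ℝ (outgoing e) y
  have key : distortion e b m σ y - 1 = (innerSL ℝ e).smulRight (solution e b m σ u - e) +
      (σ⁻¹ • T - proj e ∘L derivDir (u - e)) ∘L (S ∘L proj e) := by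
    ext1 w
    have := congrArg (fun A : Vec d →L[ℝ] Vec d => A (proj e w))
      (proj_comp_derivDir_comp he h.m_pos hy)
    simp only [ContinuousLinearMap.comp_apply, proj_proj he] at this
    simp only [distortion, sub_apply, add_apply, ContinuousLinearMap.comp_apply, smul_apply,
      ContinuousLinearMap.smulRight_apply, innerSL_apply_apply, one_apply_eq_self]
    rw [this, proj_apply]
    module
  have h1 : ‖(innerSL ℝ e).smulRight (solution e b m σ u - e)‖ ≤ 2 * (L * σ) := by
    rw [ContinuousLinearMap.norm_smulRight_apply, innerSL_apply_norm, he, one_mul]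
    exact h.norm_solution_sub_le hu
  have h2 : ‖(σ⁻¹ • T - proj e ∘L derivDir (u - e)) ∘L (S ∘L proj e)‖ ≤
      58 * L ^ 3 * σ * (6 * L * 1) := by
    refine (ContinuousLinearMap.opNorm_comp_le _ _).trans ?_
    gcongr
    · exact h.norm_inv_smul_fderiv_solution_sub_le hu
    · refine (ContinuousLinearMap.opNorm_comp_le _ _).trans ?_
      gcongr
      · exact (norm_fderiv_outgoing_le he h.m_pos hy).trans (by linarith [h.inv_le])
      · exact norm_proj_le he
  rw [key]
  refine (norm_add_le _ _).trans ((add_le_add h1 h2).trans ?_)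
  have h3 : L ≤ L ^ 4 := le_self_pow₀ (by linarith) (by norm_num)
  have h4 : 0 ≤ σ * (L ^ 4 - L) := mul_nonneg hσ.le (by linarith)
  have h5 : 0 ≤ σ * L := by positivity
  nlinarith

/-- The map from a cylinder over the disc to the cone over the set of incoming directions. -/
def coneMap (e : Vec d) (b : Vec d → Vec d) (m σ : ℝ) (y : Vec d) : Vec d :=
  ⟪e, y⟫ • solution e b m σ (outgoing e y)

theorem hasFDerivAt_coneMap (h : Perturbation e b m L σ) {y : Vec d}
    (hy : m < Real.sqrt (1 - ‖proj e y‖ ^ 2)) :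
    HasFDerivAt (coneMap e b m σ)
      (distortion e b m σ (proj e y) ∘L stretch e ⟪e, y⟫ ∘L stretch e σ) y := by
  have he := h.norm_e
  have hu := (lt_norm_outgoing_sub_iff he (norm_proj_lt_one h.m_pos hy).le).2 hy
  have hy' : m < Real.sqrt (1 - ‖proj e (proj e y)‖ ^ 2) := by rwa [proj_proj he]
  have hout : HasFDerivAt (outgoing e) (fderiv ℝ (outgoing e) (proj e y) ∘L proj e) y := by
    have h1 := (((contDiffOn_outgoing h.m_pos).contDiffAt
      ((isOpen_disc e m).mem_nhds hy')).differentiableAt one_ne_zero).hasFDerivAt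
    refine (h1.comp y (proj e).hasFDerivAt).congr_of_eventuallyEq (.of_forall fun w => ?_)
    exact (outgoing_proj he w).symm
  have hψ := (h.differentiableAt_solution hu).hasFDerivAt.comp y hout
  refine ((innerSL ℝ e).hasFDerivAt.smul hψ).congr_fderiv ?_
  have hσ := h.σ_pos.ne'
  ext1 w
  simp only [stretch_comp_stretch he, distortion, outgoing_proj he, ContinuousLinearMap.comp_apply,
    stretch_apply, add_apply, smul_apply, ContinuousLinearMap.smulRight_apply, innerSL_apply_apply,
    Function.comp_apply, map_add, map_smul, proj_proj he,
    inner_proj_right he, proj_self he, real_inner_self_eq_norm_sq, map_zero]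
  rw [he]
  match_scalars <;> field_simp
  ring

open scoped Pointwise in
theorem image_coneMap (h : Perturbation e b m L σ) {A : Set (Vec d)}
    (hA : ∀ u ∈ A, ‖u‖ = 1 ∧ 2 * m < ‖u - e‖) :
    coneMap e b m σ '' {y | ⟪e, y⟫ ∈ Ioo (0 : ℝ) 1 ∧ ‖proj e y‖ < 1 ∧ outgoing e y ∈ A} =
      Ioo (0 : ℝ) 1 • (solution e b m σ '' A) := by
  have he := h.norm_e
  ext w
  constructor
  · rintro ⟨y, ⟨hy1, -, hy3⟩, rfl⟩
    exact smul_mem_smul hy1 (mem_image_of_mem _ hy3)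
  · rintro ⟨t, ht, -, ⟨u, hu, rfl⟩, rfl⟩
    obtain ⟨h1, h2⟩ := hA u hu
    have hue : u ≠ e := by
      rintro rfl
      rw [sub_self, norm_zero] at h2
      linarith [h.m_pos]
    obtain ⟨h3, h4⟩ := outgoing_eq he h1 hue
    set x := dir (u - e)
    have hx : proj e (t • e + proj e x) = proj e x := by
      rw [map_add, map_smul, proj_self he, smul_zero, zero_add, proj_proj he]
    have hin : ⟪e, t • e + proj e x⟫ = t := by
      rw [inner_add_right, inner_smul_right, real_inner_self_eq_norm_sq, he, inner_proj_right he]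
      ring
    have hout : outgoing e (t • e + proj e x) = u := by
      rw [← outgoing_proj he, hx, outgoing_proj he, h3]
    refine ⟨t • e + proj e x, ⟨by rwa [hin], by rwa [hx], by rwa [hout]⟩, ?_⟩
    simp only [coneMap, hin, hout]

theorem injOn_coneMap (h : Perturbation e b m L σ) {A : Set (Vec d)}
    (hA : ∀ u ∈ A, ‖u‖ = 1 ∧ 2 * m < ‖u - e‖) (hinj : InjOn (solution e b m σ) A) :
    InjOn (coneMap e b m σ)
      {y | ⟪e, y⟫ ∈ Ioo (0 : ℝ) 1 ∧ ‖proj e y‖ < 1 ∧ outgoing e y ∈ A} := by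
  have he := h.norm_e
  have hnorm : ∀ y : Vec d, 0 < ⟪e, y⟫ → outgoing e y ∈ A → ‖coneMap e b m σ y‖ = ⟪e, y⟫ := by
    intro y h1 h2
    rw [coneMap, norm_smul, h.norm_solution (hA _ h2).2, mul_one, Real.norm_of_nonneg h1.le]
  rintro y ⟨hy1, hy2, hy3⟩ z ⟨hz1, hz2, hz3⟩ hyz
  have hin : ⟪e, y⟫ = ⟪e, z⟫ := by
    rw [← hnorm y hy1.1 hy3, hyz, hnorm z hz1.1 hz3]
  have hsol : solution e b m σ (outgoing e y) = solution e b m σ (outgoing e z) := by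
    simp only [coneMap, hin] at hyz
    exact smul_right_injective _ hz1.1.ne' hyz
  have hout := hinj hy3 hz3 hsol
  have hhemi : hemi e y = hemi e z := by
    rw [← dir_outgoing_sub he hy2, hout, dir_outgoing_sub he hz2]
  have hproj : proj e y = proj e z := by rw [← proj_hemi he y, hhemi, proj_hemi he z]
  rw [proj_apply, proj_apply, hin] at hproj
  exact sub_left_injective hproj

end Perturbation

section Fubini

variable {e : Vec d}

theorem mem_span_orthogonal {x : Vec d} : x ∈ (ℝ ∙ e)ᗮ ↔ ⟪e, x⟫ = 0 :=
  Submodule.mem_orthogonal_singleton_iff_inner_right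

/-- The decomposition of space along the unit vector `e`. -/
def splitEquiv (he : ‖e‖ = 1) : ((ℝ ∙ e)ᗮ × ℝ) ≃L[ℝ] Vec d :=
  ContinuousLinearEquiv.equivOfInverse
    ((ℝ ∙ e)ᗮ.subtypeL ∘L .fst ℝ _ ℝ + (ContinuousLinearMap.snd ℝ (ℝ ∙ e)ᗮ ℝ).smulRight e)
    (((proj e).codRestrict (ℝ ∙ e)ᗮ fun y => mem_span_orthogonal.2 (inner_proj_right he y)).prod
      (innerSL ℝ e))
    (fun p => by
      have h : ⟪e, (p.1 : Vec d)⟫ = 0 := mem_span_orthogonal.1 p.1.2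
      ext1
      · ext1
        simp [proj_self he, proj_apply, h]
      · simp [inner_add_right, inner_smul_right, he, h])
    (fun y => by simp [proj_apply])

theorem proj_splitEquiv (he : ‖e‖ = 1) (p : (ℝ ∙ e)ᗮ × ℝ) : proj e (splitEquiv he p) = p.1 := by
  exact congrArg (fun q => (q.1 : Vec d)) ((splitEquiv he).symm_apply_apply p)

theorem inner_splitEquiv (he : ‖e‖ = 1) (p : (ℝ ∙ e)ᗮ × ℝ) : ⟪e, splitEquiv he p⟫ = p.2 := by
  exact congrArg (fun q => q.2) ((splitEquiv he).symm_apply_apply p)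

theorem finrank_orthogonal (he : ‖e‖ = 1) : (Module.finrank ℝ (ℝ ∙ e)ᗮ : ℝ) = (d : ℝ) - 1 := by
  have h1 := (ℝ ∙ e).finrank_add_finrank_orthogonal
  rw [finrank_span_singleton (norm_ne_zero_iff.1 (he.trans_ne one_ne_zero)),
    finrank_euclideanSpace_fin] at h1
  have h2 := congrArg (Nat.cast : ℕ → ℝ) h1
  push_cast at h2
  linarith

theorem map_val_hausdorffMeasure (he : ‖e‖ = 1) :
    Measure.map Subtype.val (μH[(Module.finrank ℝ (ℝ ∙ e)ᗮ : ℝ)] : Measure (ℝ ∙ e)ᗮ) =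
      (μH[(d : ℝ) - 1]).restrict {x | ⟪e, x⟫ = 0} := by
  rw [isometry_subtype_coe.map_hausdorffMeasure (Or.inl (Nat.cast_nonneg _)),
    finrank_orthogonal he]
  congr 1
  ext x
  simp [Submodule.mem_orthogonal_singleton_iff_inner_right]

theorem exists_lintegral_proj_mul (he : ‖e‖ = 1) :
    ∃ c : ℝ≥0∞, c ≠ 0 ∧ c ≠ ∞ ∧ ∀ (f : Vec d → ℝ≥0∞) (q : ℝ → ℝ≥0∞), Measurable f →
      Measurable q → ∫⁻ y, f (proj e y) * q ⟪e, y⟫ =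
        c * ((∫⁻ x in {x | ⟪e, x⟫ = 0}, f x ∂μH[(d : ℝ) - 1]) * ∫⁻ t, q t) := by
  set μ₀ : Measure (ℝ ∙ e)ᗮ := μH[(Module.finrank ℝ (ℝ ∙ e)ᗮ : ℝ)]
  set ν : Measure (Vec d) := (μ₀.prod (volume : Measure ℝ)).map (splitEquiv he)
  have hν : (volume : Measure (Vec d)) =
      Measure.addHaarScalarFactor volume ν • ν := Measure.isAddLeftInvariant_eq_smul _ _
  have hpos := Measure.addHaarScalarFactor_pos_of_isAddHaarMeasure (volume : Measure (Vec d)) ν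
  generalize Measure.addHaarScalarFactor (volume : Measure (Vec d)) ν = c at hν hpos
  refine ⟨c, ENNReal.coe_ne_zero.2 hpos.ne', ENNReal.coe_ne_top, fun f q hf hq => ?_⟩
  rw [hν, lintegral_smul_measure, ENNReal.smul_def, smul_eq_mul]
  congr 1
  have hm : Measurable (splitEquiv he) := (splitEquiv he).continuous.measurable
  rw [lintegral_map (by fun_prop) hm]
  simp only [proj_splitEquiv, inner_splitEquiv]
  rw [lintegral_prod_mul (f := fun x : (ℝ ∙ e)ᗮ => f x) (by fun_prop) (by fun_prop),
    ← map_val_hausdorffMeasure he, lintegral_map hf measurable_subtype_coe]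

theorem hausdorffMeasure_disc (he : ‖e‖ = 1) :
    (μH[(d : ℝ) - 1]).restrict {x : Vec d | ⟪e, x⟫ = 0} (ball 0 1) ≠ 0 ∧
      (μH[(d : ℝ) - 1]).restrict {x : Vec d | ⟪e, x⟫ = 0} (ball 0 1) ≠ ∞ := by
  have h : (Subtype.val ⁻¹' ball (0 : Vec d) 1 : Set (ℝ ∙ e)ᗮ) = ball 0 1 := by
    ext x
    simp
  rw [← map_val_hausdorffMeasure he, Measure.map_apply measurable_subtype_coe measurableSet_ball, h]
  exact ⟨(measure_ball_pos _ _ one_pos).ne', measure_ball_ne_top⟩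

end Fubini

theorem measurable_indicator {f : Vec d → ℝ≥0∞} {A : Set (Vec d)} (hf : ContinuousOn f A)
    (hA : MeasurableSet A) : Measurable (A.indicator f) := by
  classical
  rw [← piecewise_eq_indicator]
  exact hf.measurable_piecewise continuousOn_const hA

namespace Perturbation

variable {e : Vec d} {b : Vec d → Vec d} {m L σ : ℝ}

theorem continuousOn_distortion (h : Perturbation e b m L σ) :
    ContinuousOn (distortion e b m σ) {y | m < Real.sqrt (1 - ‖proj e y‖ ^ 2)} := by
  have he := h.norm_e
  have hout := contDiffOn_outgoing (e := e) h.m_pos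
  have hmaps : MapsTo (outgoing e) {y | m < Real.sqrt (1 - ‖proj e y‖ ^ 2)}
      {u | 2 * m < ‖u - e‖} :=
    fun y hy => (lt_norm_outgoing_sub_iff he (norm_proj_lt_one h.m_pos hy).le).2 hy
  have h1 := h.contDiffOn_solution.continuousOn.comp hout.continuousOn hmaps
  have h2 := (h.contDiffOn_solution.continuousOn_fderiv_of_isOpen
    (isOpen_outgoing e m) le_rfl).comp hout.continuousOn hmaps
  have h3 := hout.continuousOn_fderiv_of_isOpen (isOpen_disc e m) le_rfl
  exact ((ContinuousLinearMap.smulRightL ℝ (Vec d) (Vec d)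
    (innerSL ℝ e)).continuous.comp_continuousOn h1).add
      ((h2.clm_comp (h3.clm_comp continuousOn_const)).const_smul σ⁻¹)

/-- The density of the surface measure of the incoming directions with respect to the scattering
measure, up to a multiplicative constant. -/
def density (e : Vec d) (b : Vec d → Vec d) (m σ : ℝ) (u : Vec d) : ℝ :=
  |(distortion e b m σ (proj e (dir (u - e)))).det|

theorem lt_sqrt_of_outgoing (h : Perturbation e b m L σ) {u : Vec d} (hu : ‖u‖ = 1)
    (hue : 2 * m < ‖u - e‖) :
    m < Real.sqrt (1 - ‖proj e (proj e (dir (u - e)))‖ ^ 2) := by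
  have hne : u ≠ e := by
    rintro rfl
    rw [sub_self, norm_zero] at hue
    linarith [h.m_pos]
  obtain ⟨h1, h2⟩ := outgoing_eq h.norm_e hu hne
  rw [proj_proj h.norm_e]
  exact (lt_norm_outgoing_sub_iff h.norm_e h2.le).1 (by rwa [h1])

theorem continuousOn_density (h : Perturbation e b m L σ) :
    ContinuousOn (density e b m σ) {u | ‖u‖ = 1 ∧ 2 * m < ‖u - e‖} := by
  have h1 : ContinuousOn (fun u => proj e (dir (u - e))) {u | ‖u‖ = 1 ∧ 2 * m < ‖u - e‖} := by
    intro u hu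
    have hne : u - e ≠ 0 := norm_pos_iff.1 (by linarith [h.m_pos, hu.2])
    have h2 : ContinuousAt (fun u => dir (u - e)) u :=
      (contDiffAt_dir hne (n := 1)).continuousAt.comp (f := fun u => u - e)
        (continuousAt_id.sub continuousAt_const)
    exact ((proj e).continuous.continuousAt.comp h2).continuousWithinAt
  exact (ContinuousLinearMap.continuous_det.comp_continuousOn (h.continuousOn_distortion.comp h1
    fun u hu => h.lt_sqrt_of_outgoing hu.1 hu.2)).abs

theorem continuous_outgoing (e : Vec d) : Continuous (outgoing e) := by
  unfold outgoing hemi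
  fun_prop

theorem continuous_stretch (e : Vec d) : Continuous (stretch e) := by
  unfold stretch
  fun_prop

theorem lintegral_det_stretch (he : ‖e‖ = 1) (hσ : σ ≠ 0) :
    ∫⁻ t in Ioo (0 : ℝ) 1, ENNReal.ofReal |(stretch e t ∘L stretch e σ).det| ≠ 0 ∧
    ∫⁻ t in Ioo (0 : ℝ) 1, ENNReal.ofReal |(stretch e t ∘L stretch e σ).det| ≠ ∞ := by
  have hc : Continuous fun t => |(stretch e t ∘L stretch e σ).det| :=
    (ContinuousLinearMap.continuous_det.comp
      ((continuous_stretch e).clm_comp continuous_const)).abs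
  constructor
  · refine ((setLIntegral_pos_iff hc.measurable.ennreal_ofReal).2 ?_).ne'
    have : Ioo (0 : ℝ) 1 ⊆
        Function.support (fun t => ENNReal.ofReal |(stretch e t ∘L stretch e σ).det|) := by
      intro t ht
      rw [Function.mem_support, stretch_comp_stretch he]
      simpa using det_stretch_ne_zero he (mul_ne_zero ht.1.ne' hσ)
    rw [inter_eq_right.2 this]
    simp
  · refine ((lintegral_mono_set Ioo_subset_Icc_self).trans_lt ?_).ne
    exact (hc.integrableOn_Icc (μ := volume)).lintegral_lt_top

theorem discMeas_eq {s : Vec d} (hs : s ≠ 0) :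
    discMeas s = ((μH[(d : ℝ) - 1]).restrict {x : Vec d | ⟪dir s, x⟫ = 0}).restrict (ball 0 1) := by
  rw [discMeas, Measure.restrict_restrict measurableSet_ball]
  congr 1
  ext x
  have : ⟪dir s, x⟫ = 0 ↔ ⟪x, s⟫ = 0 := by
    rw [dir, inner_smul_left, real_inner_comm]
    simp [hs]
  simp [this, and_comm]

theorem discMeas_univ {s : Vec d} (hs : s ≠ 0) :
    discMeas s univ ≠ 0 ∧ discMeas s univ ≠ ∞ := by
  rw [discMeas_eq hs, Measure.restrict_apply_univ]
  exact hausdorffMeasure_disc (norm_dir hs)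

theorem continuous_scatterDir (s : Vec d) : Continuous (scatterDir s) := by
  unfold scatterDir
  fun_prop

theorem setLIntegral_lamS {s : Vec d} (hs : s ≠ 0) {A : Set (Vec d)} (hA : MeasurableSet A)
    {j : Vec d → ℝ≥0∞} (hj : Measurable (A.indicator j)) :
    discMeas s univ * ∫⁻ u in A, j u ∂lamS s =
      ∫⁻ x in {x | ⟪dir s, x⟫ = 0} ∩ {x | ‖x‖ < 1 ∧ outgoing (dir s) x ∈ A},
        j (outgoing (dir s) x) ∂μH[(d : ℝ) - 1] := by
  obtain ⟨h0, h1⟩ := discMeas_univ hs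
  have hout := (continuous_outgoing (dir s)).measurable
  have hU : MeasurableSet {x | ‖x‖ < 1 ∧ outgoing (dir s) x ∈ A} :=
    (measurableSet_lt measurable_norm measurable_const).inter (hout hA)
  rw [← lintegral_indicator hA, lamS, lintegral_smul_measure, smul_eq_mul, ← mul_assoc,
    ENNReal.mul_inv_cancel h0 h1, one_mul, lintegral_map hj (continuous_scatterDir s).measurable,
    discMeas_eq hs, Measure.restrict_restrict measurableSet_ball, inter_comm (ball _ _)]
  have hH : MeasurableSet {x : Vec d | ⟪dir s, x⟫ = 0} :=
    measurableSet_eq_fun (by fun_prop) measurable_const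
  rw [← lintegral_indicator (hH.inter measurableSet_ball), ← lintegral_indicator (hH.inter hU)]
  congr 1
  ext x
  by_cases hx : ⟪dir s, x⟫ = 0
  · have h2 : proj (dir s) x = x := by rw [proj_apply, hx, zero_smul, sub_zero]
    have h3 : scatterDir s x = outgoing (dir s) x := by
      rw [← scatterDir_proj hs, h2]
    by_cases hb : ‖x‖ < 1
    · by_cases ho : outgoing (dir s) x ∈ A <;> simp [indicator, hx, hb, ho, h3]
    · simp [hb]
  · simp [hx]

theorem sphVol_eq {S : Set (Vec d)} (hS : MeasurableSet S) (hS1 : S ⊆ sph d) :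
    sphVol d S = d * volume (image2 (fun (t : ℝ) x => t • x) (Ioo 0 1) S) := by
  have h1 : sphere (0 : Vec d) 1 ∩ S = S := inter_eq_self_of_subset_right hS1
  rw [sphVol, Measure.map_apply measurable_subtype_coe hS,
    Measure.toSphere_apply' _ (measurable_subtype_coe hS), finrank_euclideanSpace_fin,
    Subtype.image_preimage_coe, h1]
  rfl

theorem measurableSet_image_solution (h : Perturbation e b m L σ)
    (hinj : InjOn (solution e b m σ) {u | ‖u‖ = 1 ∧ 2 * m < ‖u - e‖}) {A : Set (Vec d)}
    (hA : MeasurableSet A) (hAV : A ⊆ {u | ‖u‖ = 1 ∧ 2 * m < ‖u - e‖}) :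
    MeasurableSet (solution e b m σ '' A) :=
  hA.image_of_continuousOn_injOn
    (h.contDiffOn_solution.continuousOn.mono fun _ hu => (hAV hu).2) (hinj.mono hAV)

/-- The surface measure of a set of incoming directions in terms of the law `λ_s` of the
outgoing ones. -/
theorem exists_sphVol_image {s : Vec d} (hs : s ≠ 0) (hd : d ≠ 0)
    (h : Perturbation (dir s) b m L σ)
    (hinj : InjOn (solution (dir s) b m σ) {u | ‖u‖ = 1 ∧ 2 * m < ‖u - dir s‖}) :
    ∃ K : ℝ≥0∞, K ≠ 0 ∧ K ≠ ∞ ∧ ∀ A : Set (Vec d), MeasurableSet A →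
      A ⊆ {u | ‖u‖ = 1 ∧ 2 * m < ‖u - dir s‖} →
      sphVol d (solution (dir s) b m σ '' A) =
        K * ∫⁻ u in A, ENNReal.ofReal (density (dir s) b m σ u) ∂lamS s := by
  have he := h.norm_e
  obtain ⟨c, hc0, hc1, hc⟩ := exists_lintegral_proj_mul he
  obtain ⟨hq0, hq1⟩ := lintegral_det_stretch he h.σ_pos.ne'
  obtain ⟨hD0, hD1⟩ := discMeas_univ hs
  set e := dir s
  set Q := ∫⁻ t in Ioo (0 : ℝ) 1, ENNReal.ofReal |(stretch e t ∘L stretch e σ).det|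
  refine ⟨d * (c * (discMeas s univ * Q)), ?_, ?_, fun A hA hAV => ?_⟩
  · simp [hd, hc0, hD0, hq0]
  · exact ENNReal.mul_ne_top (ENNReal.natCast_ne_top d)
      (ENNReal.mul_ne_top hc1 (ENNReal.mul_ne_top hD1 hq1))
  have hout := (continuous_outgoing e).measurable
  set U := {x | ‖x‖ < 1 ∧ outgoing e x ∈ A} with hUdef
  have hU : MeasurableSet U := (measurableSet_lt measurable_norm measurable_const).inter (hout hA)
  have hUO : U ⊆ {y | m < Real.sqrt (1 - ‖proj e y‖ ^ 2)} := fun x hx =>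
    (lt_norm_outgoing_sub_iff he (((proj e).le_of_opNorm_le (norm_proj_le he) x).trans
      (by linarith [hx.1]))).1 (hAV hx.2).2
  set f : Vec d → ℝ≥0∞ := U.indicator fun x => ENNReal.ofReal |(distortion e b m σ x).det| with hf
  have hfm : Measurable f := by
    have h1 : ContinuousOn (fun x => ENNReal.ofReal |(distortion e b m σ x).det|) U :=
      ENNReal.continuous_ofReal.comp_continuousOn
        (ContinuousLinearMap.continuous_det.comp_continuousOn
          (h.continuousOn_distortion.mono hUO)).abs
    exact measurable_indicator h1 hU
  set q : ℝ → ℝ≥0∞ := (Ioo 0 1).indicator fun t =>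
    ENNReal.ofReal |(stretch e t ∘L stretch e σ).det| with hq
  have hqm : Measurable q := by
    refine Measurable.indicator ?_ measurableSet_Ioo
    exact (ContinuousLinearMap.continuous_det.comp
      ((continuous_stretch e).clm_comp continuous_const)).abs.measurable.ennreal_ofReal
  set Y := {y | ⟪e, y⟫ ∈ Ioo (0 : ℝ) 1 ∧ ‖proj e y‖ < 1 ∧ outgoing e y ∈ A} with hY
  have hYU : ∀ y, y ∈ Y ↔ ⟪e, y⟫ ∈ Ioo (0 : ℝ) 1 ∧ proj e y ∈ U := by
    intro y
    rw [hY, hUdef, mem_ofPred_eq, mem_ofPred_eq, outgoing_proj he]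
  have hYm : MeasurableSet Y := by
    refine MeasurableSet.inter
      ((show Measurable fun y : Vec d => ⟪e, y⟫ by fun_prop) measurableSet_Ioo) ?_
    exact (measurableSet_lt (proj e).continuous.norm.measurable measurable_const).inter
      (hout hA)
  have hcone : volume (coneMap e b m σ '' Y) = ∫⁻ y, f (proj e y) * q ⟪e, y⟫ := by
    rw [← lintegral_abs_det_fderiv_eq_addHaar_image volume hYm (fun y hy =>
      (h.hasFDerivAt_coneMap (by
        have := hUO ((hYU y).1 hy).2
        rwa [mem_ofPred_eq, proj_proj he] at this)).hasFDerivWithinAt)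
      (h.injOn_coneMap hAV (hinj.mono hAV)), ← lintegral_indicator hYm]
    congr 1
    ext y
    by_cases h1 : y ∈ Y
    · obtain ⟨h2, h3⟩ := (hYU y).1 h1
      rw [indicator_of_mem h1, hf, hq, indicator_of_mem h2, indicator_of_mem h3,
        ← ENNReal.ofReal_mul (abs_nonneg _), ← abs_mul]
      congr 2
      exact LinearMap.det_comp _ _
    · rw [indicator_of_notMem h1]
      rw [hYU, not_and_or] at h1
      rcases h1 with h1 | h1
      · rw [hq, indicator_of_notMem h1, mul_zero]
      · rw [hf, indicator_of_notMem h1, zero_mul]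
  have hjm : Measurable (A.indicator fun u => ENNReal.ofReal (density e b m σ u)) :=
    measurable_indicator (ENNReal.continuous_ofReal.comp_continuousOn
      (h.continuousOn_density.mono hAV)) hA
  have hlam := setLIntegral_lamS hs hA hjm
  have hfint : ∫⁻ x in {x | ⟪e, x⟫ = 0}, f x ∂μH[(d : ℝ) - 1] =
      discMeas s univ * ∫⁻ u in A, ENNReal.ofReal (density e b m σ u) ∂lamS s := by
    have hH : MeasurableSet {x : Vec d | ⟪e, x⟫ = 0} :=
      measurableSet_eq_fun (by fun_prop) measurable_const
    rw [hlam, hf, lintegral_indicator hU, Measure.restrict_restrict hU, inter_comm U]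
    refine setLIntegral_congr_fun (hH.inter hU) fun x hx => ?_
    have h2 : proj e x = x := by rw [proj_apply, hx.1, zero_smul, sub_zero]
    have h3 : ‖proj e x‖ < 1 := by rw [h2]; exact hx.2.1
    simp only [density]
    rw [dir_outgoing_sub he h3, proj_hemi he, h2]
  rw [sphVol_eq (h.measurableSet_image_solution hinj hA hAV)
    (by rintro - ⟨u, hu, rfl⟩; exact mem_sphere_zero_iff_norm.2 (h.norm_solution (hAV hu).2))]
  have himg := h.image_coneMap hAV
  rw [← image2_smul] at himg
  rw [← himg, hcone, hc f q hfm hqm, hfint, lintegral_indicator measurableSet_Ioo]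
  ring

end Perturbation

theorem exists_det_near_one (d : ℕ) {ε : ℝ} (hε : 0 < ε) :
    ∃ δ > 0, ∀ A : Vec d →L[ℝ] Vec d, ‖A - 1‖ < δ → |A.det| ∈ Icc (1 - ε) (1 + ε) := by
  have h1 : Tendsto (fun A : Vec d →L[ℝ] Vec d => |A.det|) (𝓝 1) (𝓝 1) := by
    have h2 : Continuous fun A : Vec d →L[ℝ] Vec d => |A.det| :=
      ContinuousLinearMap.continuous_det.abs
    have h3 : |(1 : Vec d →L[ℝ] Vec d).det| = 1 := by
      rw [show (1 : Vec d →L[ℝ] Vec d).det = 1 from LinearMap.det_id, abs_one]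
    exact h3 ▸ h2.tendsto 1
  obtain ⟨δ, hδ, h4⟩ := Metric.tendsto_nhds_nhds.1 h1 ε hε
  refine ⟨δ, hδ, fun A hA => ?_⟩
  have h5 := h4 (x := A) (by rwa [dist_eq_norm])
  rw [Real.dist_eq, abs_sub_lt_iff] at h5
  constructor <;> linarith [h5.1, h5.2]

theorem lamS_ne_top (s : Vec d) (M : Set (Vec d)) : lamS s M ≠ ∞ := by
  refine ne_top_of_le_ne_top ENNReal.one_ne_top ((measure_mono (subset_univ M)).trans ?_)
  rw [lamS, Measure.smul_apply, Measure.map_apply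
    (Perturbation.continuous_scatterDir s).measurable .univ, preimage_univ, smul_eq_mul]
  exact ENNReal.inv_mul_le_one _

namespace Perturbation

variable {b : Vec d → Vec d} {m L σ : ℝ} {s : Vec d}

theorem exists_map_eq_withDensity (hs : s ≠ 0) (hd : d ≠ 0) (h : Perturbation (dir s) b m L σ)
    {F : Vec d → Vec d}
    (hF : ∀ u ∈ {u | ‖u‖ = 1 ∧ 2 * m < ‖u - dir s‖}, F (solution (dir s) b m σ u) = u)
    {M : Set (Vec d)} (hM : MeasurableSet M) (hMV : M ⊆ {u | ‖u‖ = 1 ∧ 2 * m < ‖u - dir s‖})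
    (hFc : ContinuousOn F (solution (dir s) b m σ '' M))
    {ε ε' : ℝ} (hε : ε' ∈ Ioo 0 1) (hεε : 2 * ε' + ε * ε' ≤ ε)
    (hj : ∀ u ∈ M, density (dir s) b m σ u ∈ Icc (1 - ε') (1 + ε')) (hpos : 0 < lamS s M) :
    ∃ g : Vec d → ℝ, ContinuousOn g M ∧ (∀ u ∈ M, g u ∈ Icc (1 - ε) (1 + ε)) ∧
      Measure.map F ((sphVol d (solution (dir s) b m σ '' M))⁻¹ •
        (sphVol d).restrict (solution (dir s) b m σ '' M)) =
      ((lamS s M)⁻¹ • (lamS s).restrict M).withDensity fun u => ENNReal.ofReal (g u) := by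
  have hinj : InjOn (solution (dir s) b m σ) {u | ‖u‖ = 1 ∧ 2 * m < ‖u - dir s‖} :=
    LeftInvOn.injOn hF
  obtain ⟨K, hK0, hK1, hK⟩ := h.exists_sphVol_image hs hd hinj
  have hN := h.measurableSet_image_solution hinj hM hMV
  set ψ := solution (dir s) b m σ
  set j := density (dir s) b m σ
  obtain ⟨hε0, hε1⟩ := hε
  have hΛ1 := lamS_ne_top s M
  set I := ∫⁻ u in M, ENNReal.ofReal (j u) ∂lamS s with hI
  have hIle : I ≤ ENNReal.ofReal (1 + ε') * lamS s M := by
    rw [← setLIntegral_const]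
    exact setLIntegral_mono' hM fun u hu => ENNReal.ofReal_le_ofReal (hj u hu).2
  have hleI : ENNReal.ofReal (1 - ε') * lamS s M ≤ I := by
    rw [← setLIntegral_const]
    exact setLIntegral_mono' hM fun u hu => ENNReal.ofReal_le_ofReal (hj u hu).1
  have hI1 : I ≠ ∞ := ne_top_of_le_ne_top (ENNReal.mul_ne_top ENNReal.ofReal_ne_top hΛ1) hIle
  have hI0 : I ≠ 0 := ne_of_gt (lt_of_lt_of_le (ENNReal.mul_pos
    (ENNReal.ofReal_pos.2 (by linarith)).ne' hpos.ne') hleI)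
  have hΛr : 0 < (lamS s M).toReal := ENNReal.toReal_pos hpos.ne' hΛ1
  have hIr : 0 < I.toReal := ENNReal.toReal_pos hI0 hI1
  have hIle' : I.toReal ≤ (1 + ε') * (lamS s M).toReal := by
    have := ENNReal.toReal_mono (ENNReal.mul_ne_top ENNReal.ofReal_ne_top hΛ1) hIle
    rwa [ENNReal.toReal_mul, ENNReal.toReal_ofReal (by linarith)] at this
  have hleI' : (1 - ε') * (lamS s M).toReal ≤ I.toReal := by
    have := ENNReal.toReal_mono hI1 hleI
    rwa [ENNReal.toReal_mul, ENNReal.toReal_ofReal (by linarith)] at this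
  set R := (lamS s M).toReal / I.toReal with hR
  have hR0 : 0 < R := div_pos hΛr hIr
  have hRle : (1 - ε') * R ≤ 1 := by
    rw [hR, ← mul_div_assoc, div_le_one hIr]
    exact hleI'
  have hleR : 1 ≤ (1 + ε') * R := by
    rw [hR, ← mul_div_assoc, one_le_div hIr]
    exact hIle'
  refine ⟨fun u => j u * R, (h.continuousOn_density.mono hMV).mul continuousOn_const,
    fun u hu => ⟨?_, ?_⟩, ?_⟩
  · have h1 : (1 - ε') * R ≤ j u * R := mul_le_mul_of_nonneg_right (hj u hu).1 hR0.le
    refine le_trans ?_ h1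
    rcases le_total 1 ε with h2 | h2
    · nlinarith
    · have h3 : (1 - ε) * (1 + ε') ≤ 1 - ε' := by nlinarith
      nlinarith [mul_le_mul_of_nonneg_right h3 hR0.le]
  · have h1 : j u * R ≤ (1 + ε') * R := mul_le_mul_of_nonneg_right (hj u hu).2 hR0.le
    refine h1.trans ?_
    have h2 : (1 + ε') * R ≤ (1 + ε) * ((1 - ε') * R) := by nlinarith
    have hε2 : 0 ≤ 1 + ε := by nlinarith
    nlinarith
  · have hRe : ENNReal.ofReal R = lamS s M * I⁻¹ := by
      rw [hR, ENNReal.ofReal_div_of_pos hIr, ENNReal.ofReal_toReal hΛ1, ENNReal.ofReal_toReal hI1]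
      rfl
    ext E hE
    have hFm : AEMeasurable F ((sphVol d (ψ '' M))⁻¹ • (sphVol d).restrict (ψ '' M)) :=
      (hFc.aemeasurable hN).smul_measure _
    have hset : F ⁻¹' E ∩ ψ '' M = ψ '' (M ∩ E) := by
      ext v
      constructor
      · rintro ⟨hv, u, hu, rfl⟩
        rw [mem_preimage, hF u (hMV hu)] at hv
        exact ⟨u, ⟨hu, hv⟩, rfl⟩
      · rintro ⟨u, ⟨hu, hv⟩, rfl⟩
        exact ⟨by rwa [mem_preimage, hF u (hMV hu)], u, hu, rfl⟩
    rw [Measure.map_apply_of_aemeasurable hFm hE, Measure.smul_apply, Measure.restrict_apply' hN,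
      hset, hK M hM hMV, hK (M ∩ E) (hM.inter hE) (inter_subset_left.trans hMV),
      withDensity_apply _ hE, Measure.restrict_smul, lintegral_smul_measure,
      Measure.restrict_restrict hE, inter_comm E, ← hI]
    have hmul : ∀ u, ENNReal.ofReal (j u * R) = ENNReal.ofReal (j u) * ENNReal.ofReal R :=
      fun u => ENNReal.ofReal_mul (abs_nonneg _)
    simp only [hmul]
    rw [lintegral_mul_const' _ _ ENNReal.ofReal_ne_top, hRe, smul_eq_mul, smul_eq_mul,
      ENNReal.mul_inv (Or.inl hK0) (Or.inl hK1)]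
    generalize ∫⁻ u in M ∩ E, ENNReal.ofReal (j u) ∂lamS s = X
    calc K⁻¹ * I⁻¹ * (K * X) = (K⁻¹ * K) * (X * I⁻¹) := by ring
      _ = ((lamS s M)⁻¹ * lamS s M) * (X * I⁻¹) := by
        rw [ENNReal.inv_mul_cancel hK0 hK1, ENNReal.inv_mul_cancel hpos.ne' hΛ1]
      _ = _ := by ring

theorem density_mem (h : Perturbation (dir s) b m L σ) {δ ε : ℝ}
    (hδ : ∀ A : Vec d →L[ℝ] Vec d, ‖A - 1‖ < δ → |A.det| ∈ Icc (1 - ε) (1 + ε))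
    (hsmall : 500 * L ^ 4 * σ < δ) {u : Vec d} (hu : ‖u‖ = 1) (hue : 2 * m < ‖u - dir s‖) :
    density (dir s) b m σ u ∈ Icc (1 - ε) (1 + ε) :=
  hδ _ ((h.norm_distortion_sub_one_le (h.lt_sqrt_of_outgoing hu hue)).trans_lt hsmall)

end Perturbation

section Ray

variable {ρ : ℝ} {s v : Vec d} {β : Vec d → Vec d}

/-- A quarter of the discriminant of the equation for the times at which the ray meets the
sphere. -/
def disc (ρ : ℝ) (s : Vec d) (β : Vec d → Vec d) (v : Vec d) : ℝ :=
  ⟪v, s - ρ • β v⟫ ^ 2 - ‖s - ρ • β v‖ ^ 2 + ρ ^ 2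

theorem mem_ball_iff_sq_lt_disc (hρ : 0 < ρ) (hv : ‖v‖ = 1) (t : ℝ) :
    ρ • β v + t • v ∈ ball s ρ ↔ (t - ⟪v, s - ρ • β v⟫) ^ 2 < disc ρ s β v := by
  have h1 : ‖ρ • β v + t • v - s‖ ^ 2 = t ^ 2 - 2 * (t * ⟪v, s - ρ • β v⟫) +
      ‖s - ρ • β v‖ ^ 2 := by
    rw [show ρ • β v + t • v - s = t • v - (s - ρ • β v) by abel, norm_sub_sq_real, norm_smul, hv,
      inner_smul_left, mul_one, Real.norm_eq_abs, sq_abs]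
    simp
  rw [mem_ball_iff_norm, ← sq_lt_sq₀ (norm_nonneg _) hρ.le, h1, disc]
  constructor <;> intro h <;> nlinarith

theorem tauB_eq (hρ : 0 < ρ) (hv : ‖v‖ = 1) (ha : ρ < ‖s - ρ • β v‖)
    (hit : ∃ t > (0 : ℝ), ρ • β v + t • v ∈ ball s ρ) :
    0 < disc ρ s β v ∧ 0 < tauB ρ s β v ∧
      tauB ρ s β v = ⟪v, s - ρ • β v⟫ - Real.sqrt (disc ρ s β v) := by
  obtain ⟨t, ht, hmem⟩ := hit
  rw [mem_ball_iff_sq_lt_disc hρ hv] at hmem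
  have hD : 0 < disc ρ s β v := (sq_nonneg _).trans_lt hmem
  have hlt : disc ρ s β v < ⟪v, s - ρ • β v⟫ ^ 2 := by
    rw [disc]
    nlinarith
  have htp := Real.lt_sqrt_of_sq_lt ((sq_abs _).trans_lt hmem)
  set p := ⟪v, s - ρ • β v⟫
  set D := disc ρ s β v
  have hp : Real.sqrt D < |p| := by
    rw [← Real.sqrt_sq_eq_abs]
    exact Real.sqrt_lt_sqrt hD.le hlt
  rw [abs_lt] at htp
  have hp0 : 0 < p := by
    by_contra hneg
    rw [abs_of_nonpos (not_lt.1 hneg)] at hp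
    linarith
  rw [abs_of_pos hp0] at hp
  have hset : {t | 0 < t ∧ ρ • β v + t • v ∈ ball s ρ} =
      Ioo (p - Real.sqrt D) (p + Real.sqrt D) := by
    ext t
    have h1 : (t - p) ^ 2 < D ↔ |t - p| < Real.sqrt D := by
      rw [← Real.sqrt_sq_eq_abs, Real.sqrt_lt_sqrt_iff (sq_nonneg _)]
    rw [mem_ofPred_eq, mem_ball_iff_sq_lt_disc hρ hv, h1, abs_lt, mem_Ioo]
    constructor
    · rintro ⟨h2, h3, h4⟩
      constructor <;> linarith
    · rintro ⟨h2, h3⟩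
      refine ⟨?_, ?_, ?_⟩ <;> linarith
  have htau : tauB ρ s β v = p - Real.sqrt D := by
    rw [tauB, hset, csInf_Ioo]
    linarith [Real.sqrt_pos.2 hD]
  exact ⟨hD, by rw [htau]; linarith, htau⟩

theorem tauB_smul_eq (hρ : 0 < ρ) :
    tauB ρ s β v • v = s + ρ • (Wmap ρ s β v - β v) := by
  rw [Wmap, smul_sub, smul_smul, mul_inv_cancel₀ hρ.ne', one_smul]
  abel

theorem norm_Wmap (hρ : 0 < ρ) (hv : ‖v‖ = 1) (ha : ρ < ‖s - ρ • β v‖)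
    (hit : ∃ t > (0 : ℝ), ρ • β v + t • v ∈ ball s ρ) :
    ‖Wmap ρ s β v‖ = 1 ∧ ⟪v, Wmap ρ s β v⟫ < 0 := by
  obtain ⟨hD, -, ht⟩ := tauB_eq hρ hv ha hit
  have hsq := Real.sq_sqrt hD.le
  have h1 : ρ • Wmap ρ s β v = tauB ρ s β v • v - (s - ρ • β v) := by
    rw [tauB_smul_eq hρ, smul_sub]
    abel
  have hin : ρ * ⟪v, Wmap ρ s β v⟫ = -Real.sqrt (disc ρ s β v) := by
    rw [← inner_smul_right, h1, inner_sub_right, inner_smul_right, real_inner_self_eq_norm_sq, hv,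
      ht]
    ring
  have hno : (ρ * ‖Wmap ρ s β v‖) ^ 2 = ρ ^ 2 := by
    have h2 : ‖ρ • Wmap ρ s β v‖ = ρ * ‖Wmap ρ s β v‖ := by
      rw [norm_smul, Real.norm_of_nonneg hρ.le]
    rw [← h2, h1, norm_sub_sq_real, norm_smul, hv, inner_smul_left, mul_one, Real.norm_eq_abs,
      sq_abs, conj_trivial, ht]
    unfold disc at hsq ⊢
    nlinarith
  constructor
  · have := (sq_eq_sq₀ (by positivity) hρ.le).1 hno
    exact mul_left_cancel₀ hρ.ne' (this.trans (mul_one ρ).symm)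
  · have := Real.sqrt_pos.2 hD
    by_contra hneg
    nlinarith [mul_nonneg hρ.le (not_lt.1 hneg)]

theorem tauB_eq_of_smul_eq (hρ : 0 < ρ) (hv : ‖v‖ = 1) {w : Vec d} (hw : ‖w‖ = 1)
    (hvw : ⟪v, w⟫ < 0) {t : ℝ} (ht : 0 < t) (heq : t • v = s + ρ • (w - β v)) :
    (∃ t > (0 : ℝ), ρ • β v + t • v ∈ ball s ρ) ∧ Wmap ρ s β v = w := by
  have ha : s - ρ • β v = t • v - ρ • w := by
    rw [heq, smul_sub]
    abel
  have hp : ⟪v, s - ρ • β v⟫ = t - ρ * ⟪v, w⟫ := by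
    rw [ha, inner_sub_right, inner_smul_right, inner_smul_right, real_inner_self_eq_norm_sq, hv]
    ring
  have hno : ‖s - ρ • β v‖ ^ 2 = t ^ 2 - 2 * t * ρ * ⟪v, w⟫ + ρ ^ 2 := by
    rw [ha, norm_sub_sq_real, norm_smul, norm_smul, hv, hw, inner_smul_left, inner_smul_right,
      Real.norm_of_nonneg hρ.le, Real.norm_of_nonneg ht.le]
    simp
    ring
  have hD : disc ρ s β v = (-(ρ * ⟪v, w⟫)) ^ 2 := by
    rw [disc, hp, hno]
    ring
  have hneg : 0 < -(ρ * ⟪v, w⟫) := by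
    rw [← mul_neg]
    exact mul_pos hρ (neg_pos.2 hvw)
  have hlt : ρ < ‖s - ρ • β v‖ := by
    rw [← sq_lt_sq₀ hρ.le (norm_nonneg _), hno]
    nlinarith
  have hit : ∃ t > (0 : ℝ), ρ • β v + t • v ∈ ball s ρ := by
    refine ⟨⟪v, s - ρ • β v⟫, by rw [hp]; linarith, ?_⟩
    rw [mem_ball_iff_sq_lt_disc hρ hv, sub_self, hD, zero_pow two_ne_zero]
    exact pow_pos hneg 2
  refine ⟨hit, ?_⟩
  have htau : tauB ρ s β v = t := by
    rw [(tauB_eq hρ hv hlt hit).2.2, hD, Real.sqrt_sq hneg.le, hp]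
    ring
  rw [Wmap, htau, heq, show ρ • β v + (s + ρ • (w - β v)) - s = ρ • w by module, smul_smul,
    inv_mul_cancel₀ hρ.ne', one_smul]

theorem Vmap_sub (ρ : ℝ) (s : Vec d) (β : Vec d → Vec d) (v : Vec d) :
    Vmap ρ s β v - v = (-(2 * ⟪v, Wmap ρ s β v⟫)) • Wmap ρ s β v := by
  rw [Vmap, neg_smul]
  abel

theorem dir_Vmap_sub (hw : ‖Wmap ρ s β v‖ = 1) (hvw : ⟪v, Wmap ρ s β v⟫ < 0) :
    dir (Vmap ρ s β v - v) = Wmap ρ s β v := by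
  rw [Vmap_sub, dir_smul (by linarith), dir_of_norm_eq_one hw]

end Ray

theorem c1On_of_contDiffAt {f g : Vec d → Vec d} {S : Set (Vec d)} (hfg : ∀ x ∈ S, f x = g x)
    (hg : ∀ x ∈ S, ContDiffAt ℝ 1 g x) : C1On f S := by
  refine ⟨fderiv ℝ g, fun x hx => ?_, fun x hx => ?_⟩
  · exact ((hg x hx).fderiv_right (m := 0) le_rfl).continuousAt.continuousWithinAt
  · exact ((hg x hx).differentiableAt one_ne_zero).hasFDerivAt.hasFDerivWithinAt.congr hfg
      (hfg x hx)

theorem dir_ne_zero {s : Vec d} (hs : s ≠ 0) : dir s ≠ 0 :=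
  norm_ne_zero_iff.1 ((norm_dir hs).trans_ne one_ne_zero)

theorem angle_dir_right {s : Vec d} (hs : s ≠ 0) (u : Vec d) : angle u (dir s) = angle u s :=
  angle_smul_right_of_pos u s (inv_pos.2 (norm_pos_iff.2 hs))

theorem lt_angle_iff {η : ℝ} (hη : η ∈ Ioo 0 Real.pi) {u e : Vec d} (hu : ‖u‖ = 1) (he : ‖e‖ = 1) :
    η < angle u e ↔ 2 * Real.sin (η / 2) < ‖u - e‖ := by
  have h1 : 0 < Real.sin (η / 2) :=
    Real.sin_pos_of_pos_of_lt_pi (by linarith [hη.1]) (by linarith [hη.1, hη.2])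
  have h2 : Real.cos η = 1 - 2 * Real.sin (η / 2) ^ 2 := by
    have := Real.cos_two_mul' (η / 2)
    rw [Real.cos_sq', mul_div_cancel₀ _ two_ne_zero] at this
    linarith
  have h3 : ‖u - e‖ ^ 2 = 2 - 2 * Real.cos (angle u e) := by
    rw [norm_sub_sq_real, cos_angle, hu, he]
    ring
  rw [← sq_lt_sq₀ (by positivity) (norm_nonneg _), h3,
    ← Real.strictAntiOn_cos.lt_iff_gt ⟨angle_nonneg u e, angle_le_pi u e⟩ ⟨hη.1.le, hη.2.le⟩, h2]
  constructor <;> intro h <;> nlinarith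

theorem mem_Vseta_iff {η : ℝ} (hη : η ∈ Ioo 0 Real.pi) {s u : Vec d} (hs : s ≠ 0) :
    u ∈ Vseta s η ↔ ‖u‖ = 1 ∧ 2 * Real.sin (η / 2) < ‖u - dir s‖ := by
  have h1 : u ∈ Vseta s η ↔ ‖u‖ = 1 ∧ η < angle u s := by
    rw [Vseta, sph]
    exact and_congr_left' mem_sphere_zero_iff_norm
  rw [h1, ← angle_dir_right hs]
  exact and_congr_right fun hu => lt_angle_iff hη hu (norm_dir hs)

theorem norm_eq_one_of_mem_Vseta {η : ℝ} {s u : Vec d} (hu : u ∈ Vseta s η) : ‖u‖ = 1 :=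
  mem_sphere_zero_iff_norm.1 hu.1

/-- A ball `s + B_ρᵈ` hit by rays starting at `ρβ(v)`, with parameters small enough for the
perturbative analysis. -/
structure Scatterer (ρ : ℝ) (r s : Vec d) (η : ℝ) (β : Vec d → Vec d) (L : ℝ) : Prop where
  ne_zero : s ≠ 0
  ρ_pos : 0 < ρ
  η_mem : η ∈ Ioo 0 Real.pi
  perturbation :
    Perturbation (dir s) (fun x => β (dir x)) (Real.sin (η / 2)) L (ρ / ‖s‖)
  dir_mem : ∀ x ∈ ball (dir s) (Real.sin (η / 2)), dir x ∈ Vseta r η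
  bound : ∀ v ∈ Vseta r η, ‖β v‖ + 1 ≤ L

namespace Scatterer

variable {ρ : ℝ} {r s : Vec d} {η : ℝ} {β : Vec d → Vec d} {L : ℝ}

/-- The incoming direction which is scattered into the direction `u`. -/
def inverse (ρ : ℝ) (s : Vec d) (η : ℝ) (β : Vec d → Vec d) : Vec d → Vec d :=
  Perturbation.solution (dir s) (fun x => β (dir x)) (Real.sin (η / 2)) (ρ / ‖s‖)

theorem norm_smul_add (h : Scatterer ρ r s η β L) (x : Vec d) :
    ‖s‖ • (dir s + (ρ / ‖s‖) • x) = s + ρ • x := by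
  rw [smul_add, norm_smul_dir, smul_smul, mul_div_cancel₀ _ (norm_ne_zero_iff.2 h.ne_zero)]

theorem dir_add_smul (h : Scatterer ρ r s η β L) (x : Vec d) :
    dir (s + ρ • x) = dir (dir s + (ρ / ‖s‖) • x) := by
  rw [← h.norm_smul_add, dir_smul (norm_pos_iff.2 h.ne_zero)]

theorem lt_norm_sub (h : Scatterer ρ r s η β L) {v : Vec d} (hv : v ∈ Vseta r η) :
    ρ < ‖s - ρ • β v‖ := by
  have h1 := h.bound v hv
  have h2 := norm_pos_iff.2 h.ne_zero
  have h3 := h.perturbation.small_one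
  have h4 := h.perturbation.two_le
  have h5 : ‖ρ • β v‖ ≤ ρ * (L - 1) := by
    rw [norm_smul, Real.norm_of_nonneg h.ρ_pos.le]
    exact mul_le_mul_of_nonneg_left (by linarith) h.ρ_pos.le
  have h6 : ρ * L < ‖s‖ := by
    have : L * (ρ / ‖s‖) < 1 := by linarith
    rwa [← mul_div_assoc, div_lt_one h2, mul_comm] at this
  have h7 := norm_sub_norm_le s (ρ • β v)
  linarith

theorem forward (h : Scatterer ρ r s η β L) {v : Vec d} (hv : v ∈ Omega ρ r s η β) :
    0 < disc ρ s β v ∧ tauB ρ s β v = ⟪v, s - ρ • β v⟫ - Real.sqrt (disc ρ s β v) ∧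
      v ∈ ball (dir s) (Real.sin (η / 2)) ∧
      dir (Vmap ρ s β v - v) = Wmap ρ s β v ∧
      dir (dir s + (ρ / ‖s‖) • (Wmap ρ s β v - β v)) = v := by
  have hv1 := norm_eq_one_of_mem_Vseta hv.1
  have ha := h.lt_norm_sub hv.1
  obtain ⟨hD, hτ, hτ'⟩ := tauB_eq h.ρ_pos hv1 ha hv.2
  obtain ⟨hw, hvw⟩ := norm_Wmap h.ρ_pos hv1 ha hv.2
  have hdir : dir (dir s + (ρ / ‖s‖) • (Wmap ρ s β v - β v)) = v := by
    rw [← h.dir_add_smul, ← tauB_smul_eq h.ρ_pos, dir_smul hτ, dir_of_norm_eq_one hv1]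
  refine ⟨hD, hτ', ?_, dir_Vmap_sub hw hvw, hdir⟩
  have hσ := h.perturbation.σ_pos
  have he := h.perturbation.norm_e
  have h1 : ‖(ρ / ‖s‖) • (Wmap ρ s β v - β v)‖ ≤ ρ / ‖s‖ * L := by
    rw [norm_smul, Real.norm_of_nonneg hσ.le]
    refine mul_le_mul_of_nonneg_left ?_ hσ.le
    linarith [norm_sub_le (Wmap ρ s β v) (β v), h.bound v hv.1]
  have h2 := norm_dir_sub_dir_le (dir s + (ρ / ‖s‖) • (Wmap ρ s β v - β v)) (dir_ne_zero h.ne_zero)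
  rw [hdir, dir_of_norm_eq_one he, he, div_one, add_sub_cancel_left] at h2
  have h3 := h.perturbation.small_m
  have h4 := h.perturbation.m_pos
  rw [mem_ball_iff_norm]
  linarith

theorem inverse_Vmap (h : Scatterer ρ r s η β L) {v : Vec d} (hv : v ∈ Delta ρ r s η β) :
    inverse ρ s η β (Vmap ρ s β v) = v := by
  obtain ⟨-, -, hb, hW, hdir⟩ := h.forward hv.1
  refine (h.perturbation.eq_solution ((mem_Vseta_iff h.η_mem h.ne_zero).1 hv.2).2 hb ?_).symm
  rw [incoming, hW, dir_of_norm_eq_one (norm_eq_one_of_mem_Vseta hv.1.1), hdir]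

theorem backward (h : Scatterer ρ r s η β L) {u : Vec d} (hu : u ∈ Vseta s η) :
    inverse ρ s η β u ∈ Delta ρ r s η β ∧ Vmap ρ s β (inverse ρ s η β u) = u ∧
      Wmap ρ s β (inverse ρ s η β u) = dir (u - inverse ρ s η β u) := by
  have hu' := (mem_Vseta_iff h.η_mem h.ne_zero).1 hu
  obtain ⟨hb, hfix⟩ := h.perturbation.solution_spec hu'.2
  have hv1 := h.perturbation.norm_solution hu'.2
  have hm := h.perturbation.le_norm_sub hu'.2 hb
  change inverse ρ s η β u ∈ ball _ _ at hb
  change incoming _ _ _ u (inverse ρ s η β u) = inverse ρ s η β u at hfix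
  change ‖inverse ρ s η β u‖ = 1 at hv1
  change _ ≤ ‖u - inverse ρ s η β u‖ at hm
  set v := inverse ρ s η β u
  have hpos : 0 < ‖u - v‖ := h.perturbation.m_pos.trans_le hm
  have hne : u - v ≠ 0 := norm_pos_iff.1 hpos
  have hvr : v ∈ Vseta r η := dir_of_norm_eq_one hv1 ▸ h.dir_mem v hb
  have hvw : ⟪v, dir (u - v)⟫ = -(‖u - v‖ / 2) := by
    have h1 : ‖u - v‖ ^ 2 = 2 - 2 * ⟪v, u⟫ := by
      rw [norm_sub_sq_real, hu'.1, hv1, real_inner_comm]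
      ring
    rw [dir, inner_smul_right, inner_sub_right, real_inner_self_eq_norm_sq, hv1]
    field_simp
    linarith
  rw [incoming, dir_of_norm_eq_one hv1, ← h.dir_add_smul] at hfix
  have hsn := norm_smul_dir (s + ρ • (dir (u - v) - β v))
  rw [hfix] at hsn
  have hlt := h.lt_norm_sub hvr
  have ht : 0 < ‖s + ρ • (dir (u - v) - β v)‖ := by
    have h1 := norm_sub_norm_le (s - ρ • β v) (-(ρ • dir (u - v)))
    rw [norm_neg, norm_smul, norm_dir hne, Real.norm_of_nonneg h.ρ_pos.le,
      show s - ρ • β v - -(ρ • dir (u - v)) = s + ρ • (dir (u - v) - β v) by module] at h1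
    linarith
  obtain ⟨hit, hW⟩ := tauB_eq_of_smul_eq h.ρ_pos hv1 (norm_dir hne) (by rw [hvw]; linarith) ht hsn
  have hV : Vmap ρ s β v = u := by
    rw [Vmap, hW, hvw, show (2 * -(‖u - v‖ / 2)) = -‖u - v‖ by ring, neg_smul, norm_smul_dir]
    abel
  exact ⟨⟨⟨hvr, hit⟩, by rwa [hV]⟩, hV, hW⟩

theorem c1On_Vmap (h : Scatterer ρ r s η β L) : C1On (Vmap ρ s β) (Delta ρ r s η β) := by
  set b : Vec d → Vec d := fun x => β (dir x)
  set p : Vec d → ℝ := fun x => ⟪x, s - ρ • b x⟫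
  set D : Vec d → ℝ := fun x => p x ^ 2 - ‖s - ρ • b x‖ ^ 2 + ρ ^ 2
  set w : Vec d → Vec d := fun x => ρ⁻¹ • (ρ • b x + (p x - Real.sqrt (D x)) • x - s)
  have hb : ∀ v ∈ Delta ρ r s η β, b v = β v := fun v hv =>
    congrArg β (dir_of_norm_eq_one (norm_eq_one_of_mem_Vseta hv.1.1))
  have hD : ∀ v ∈ Delta ρ r s η β, D v = disc ρ s β v := fun v hv => by
    simp only [D, p, hb v hv, disc]
  have hw : ∀ v ∈ Delta ρ r s η β, w v = Wmap ρ s β v := fun v hv => by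
    simp only [w, hD v hv, hb v hv, p, Wmap, (h.forward hv.1).2.1]
  refine c1On_of_contDiffAt (g := fun x => x - (2 * ⟪x, w x⟫) • w x) (fun v hv => ?_)
    fun v hv => ?_
  · simp only [hw v hv, Vmap]
  · obtain ⟨hpos, -, hball, -⟩ := h.forward hv.1
    have hbv : ContDiffAt ℝ 1 b v :=
      h.perturbation.contDiffOn.contDiffAt (isOpen_ball.mem_nhds hball)
    have hav : ContDiffAt ℝ 1 (fun x => s - ρ • b x) v := contDiffAt_const.sub (hbv.const_smul ρ)
    have hpv : ContDiffAt ℝ 1 p v := contDiffAt_id.inner ℝ hav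
    have hDv : ContDiffAt ℝ 1 D v := ((hpv.pow 2).sub (hav.norm_sq ℝ)).add contDiffAt_const
    have hsv : ContDiffAt ℝ 1 (fun x => Real.sqrt (D x)) v :=
      hDv.sqrt (by rw [hD v hv]; exact hpos.ne')
    have hwv : ContDiffAt ℝ 1 w v :=
      (((hbv.const_smul ρ).add ((hpv.sub hsv).smul contDiffAt_id)).sub contDiffAt_const).const_smul
        ρ⁻¹
    exact contDiffAt_id.sub ((contDiffAt_const.mul (contDiffAt_id.inner ℝ hwv)).smul hwv)

theorem c1On_inverse (h : Scatterer ρ r s η β L) : C1On (inverse ρ s η β) (Vseta s η) :=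
  c1On_of_contDiffAt (fun _ _ => rfl) fun _ hu => h.perturbation.contDiffOn_solution.contDiffAt
    ((Perturbation.isOpen_outgoing _ _).mem_nhds ((mem_Vseta_iff h.η_mem h.ne_zero).1 hu).2)

end Scatterer

theorem derivDir_of_norm_eq_one {u : Vec d} (hu : ‖u‖ = 1) : derivDir u = proj u := by
  rw [derivDir, hu, inv_one, one_smul, dir_of_norm_eq_one hu]

/-- The ideal impact location has tangential derivative at most `C_η - 1`. -/
theorem norm_derivDir_sub_comp_proj_le {η : ℝ} (hη : η ∈ Ioo 0 Real.pi) {u e : Vec d}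
    (hu : ‖u‖ = 1) (he : ‖e‖ = 1) (hue : η < angle u e) :
    ‖derivDir (u - e) ∘L proj u‖ ≤ Ceta d η - 1 := by
  have hm : 0 < Real.sin (η / 2) :=
    Real.sin_pos_of_pos_of_lt_pi (by linarith [hη.1]) (by linarith [hη.1, hη.2])
  have hderiv : ∀ v ∈ sph d, ∀ w ∈ sph d, η < angle w v →
      fderiv ℝ (impact v) w = derivDir (w - v) ∧ ‖derivDir (w - v)‖ ≤ (2 * Real.sin (η / 2))⁻¹ := by
    intro v hv w hw hwv
    have h1 := (lt_angle_iff hη (mem_sphere_zero_iff_norm.1 hw)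
      (mem_sphere_zero_iff_norm.1 hv)).1 hwv
    have h2 : w - v ≠ 0 := norm_pos_iff.1 (lt_trans (by positivity) h1)
    refine ⟨?_, norm_derivDir_le (by positivity) h1.le⟩
    have := (hasStrictFDerivAt_dir h2).hasFDerivAt.comp w ((hasFDerivAt_id w).sub_const v)
    exact this.fderiv
  rw [Ceta, add_sub_cancel_left]
  set S := {c | ∃ v ∈ sph d, ∃ u ∈ sph d, η < angle u v ∧
    ∃ h : Vec d, ⟪u, h⟫ = 0 ∧ ‖h‖ = 1 ∧ c = ‖fderiv ℝ (impact v) u h‖} with hS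
  have hbdd : BddAbove S := by
    refine ⟨(2 * Real.sin (η / 2))⁻¹, ?_⟩
    rintro _ ⟨v, hv, w, hw, hwv, h, -, hh, rfl⟩
    obtain ⟨h1, h2⟩ := hderiv v hv w hw hwv
    rw [h1]
    simpa [hh] using ((derivDir (w - v)).le_opNorm h).trans
      (mul_le_mul_of_nonneg_right h2 (norm_nonneg h))
  have hS0 : 0 ≤ sSup S := by
    refine Real.sSup_nonneg ?_
    rintro _ ⟨v, hv, w, hw, hwv, h, -, hh, rfl⟩
    exact norm_nonneg _
  refine ContinuousLinearMap.opNorm_le_bound _ hS0 fun x => ?_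
  rw [ContinuousLinearMap.comp_apply]
  rcases eq_or_ne (proj u x) 0 with h0 | h0
  · rw [h0, map_zero, norm_zero]
    positivity
  have hmem : ‖derivDir (u - e) (dir (proj u x))‖ ∈ S := by
    have hu' : u ∈ sph d := mem_sphere_zero_iff_norm.2 hu
    have he' : e ∈ sph d := mem_sphere_zero_iff_norm.2 he
    refine ⟨e, he', u, hu', hue, dir (proj u x), ?_, norm_dir h0, ?_⟩
    · rw [dir, inner_smul_right, inner_proj_right hu, mul_zero]
    · rw [(hderiv e he' u hu' hue).1]
  calc ‖derivDir (u - e) (proj u x)‖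
      = ‖proj u x‖ * ‖derivDir (u - e) (dir (proj u x))‖ := by
        conv_lhs => rw [← norm_smul_dir (proj u x)]
        rw [map_smul, norm_smul, norm_norm]
    _ ≤ (1 * ‖x‖) * sSup S := by
        gcongr
        · exact (proj u).le_of_opNorm_le (norm_proj_le hu) x
        · exact le_csSup hbdd hmem
    _ = _ := by ring

namespace Scatterer

variable {ρ : ℝ} {r s : Vec d} {η : ℝ} {β : Vec d → Vec d} {L : ℝ}

theorem bijOn_Vmap (h : Scatterer ρ r s η β L) :
    BijOn (Vmap ρ s β) (Delta ρ r s η β) (Vseta s η) :=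
  ⟨fun _ hv => hv.2, LeftInvOn.injOn fun _ hv => h.inverse_Vmap hv,
    fun _ hu => ⟨_, (h.backward hu).1, (h.backward hu).2.1⟩⟩

theorem Delta_inter_preimage (h : Scatterer ρ r s η β L) {M : Set (Vec d)} (hM : M ⊆ Vseta s η) :
    Delta ρ r s η β ∩ Vmap ρ s β ⁻¹' M = inverse ρ s η β '' M := by
  ext v
  constructor
  · rintro ⟨hv, hvM⟩
    exact ⟨_, hvM, h.inverse_Vmap hv⟩
  · rintro ⟨u, hu, rfl⟩
    have h1 := h.backward (hM hu)
    exact ⟨h1.1, by rwa [mem_preimage, h1.2.1]⟩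

theorem exists_density (h : Scatterer ρ r s η β L) (hd : d ≠ 0) {ε ε' δ : ℝ}
    (hε' : ε' ∈ Ioo 0 1) (hεε : 2 * ε' + ε * ε' ≤ ε)
    (hδ : ∀ A : Vec d →L[ℝ] Vec d, ‖A - 1‖ < δ → |A.det| ∈ Icc (1 - ε') (1 + ε'))
    (hsmall : 500 * L ^ 4 * (ρ / ‖s‖) < δ) {M : Set (Vec d)} (hM : MeasurableSet M)
    (hMV : M ⊆ Vseta s η) (hpos : 0 < lamS s M) :
    ∃ g : Vec d → ℝ, ContinuousOn g M ∧ (∀ u ∈ M, g u ∈ Icc (1 - ε) (1 + ε)) ∧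
      Measure.map (Vmap ρ s β)
          ((sphVol d (Delta ρ r s η β ∩ Vmap ρ s β ⁻¹' M))⁻¹ •
            (sphVol d).restrict (Delta ρ r s η β ∩ Vmap ρ s β ⁻¹' M)) =
        ((lamS s M)⁻¹ • (lamS s).restrict M).withDensity fun u => ENNReal.ofReal (g u) := by
  have hV : ∀ u, u ∈ Vseta s η ↔ ‖u‖ = 1 ∧ 2 * Real.sin (η / 2) < ‖u - dir s‖ := fun u =>
    mem_Vseta_iff h.η_mem h.ne_zero
  obtain ⟨D, -, hD⟩ := h.c1On_Vmap
  rw [h.Delta_inter_preimage hMV]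
  refine h.perturbation.exists_map_eq_withDensity h.ne_zero hd
    (fun u hu => (h.backward ((hV u).2 hu)).2.1) hM (fun u hu => (hV u).1 (hMV hu)) ?_ hε' hεε
    (fun u hu => ?_) hpos
  · change ContinuousOn _ (inverse ρ s η β '' M)
    rw [← h.Delta_inter_preimage hMV]
    exact fun v hv => (hD v hv.1).continuousWithinAt.mono inter_subset_left
  · obtain ⟨h1, h2⟩ := (hV u).1 (hMV hu)
    exact h.perturbation.density_mem hδ hsmall h1 h2

theorem norm_Wmap_inverse_sub_lt (h : Scatterer ρ r s η β L) {ε : ℝ}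
    (hsmall : 4 * L ^ 2 * (ρ / ‖s‖) < ε) {u : Vec d} (hu : u ∈ Vseta s η) :
    ‖Wmap ρ s β (inverse ρ s η β u) - impact (dir s) u‖ < ε := by
  have hu' := ((mem_Vseta_iff h.η_mem h.ne_zero).1 hu).2
  have hm := h.perturbation.m_pos
  have hL := h.perturbation.two_le
  rw [(h.backward hu).2.2, impact_eq_dir]
  refine (h.perturbation.norm_dir_sub_le _ (by linarith)).trans_lt (lt_of_le_of_lt ?_ hsmall)
  have h1 := h.perturbation.norm_solution_sub_le hu'
  rw [sub_sub_sub_cancel_left, norm_sub_rev]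
  calc _ ≤ 2 * L * (2 * (L * (ρ / ‖s‖))) := mul_le_mul_of_nonneg_left h1 (by positivity)
    _ = _ := by ring

theorem exists_deriv_Wmap_inverse (h : Scatterer ρ r s η β L) :
    ∃ DB : Vec d → Vec d →L[ℝ] Vec d, ContinuousOn DB (Vseta s η) ∧ ∀ u ∈ Vseta s η,
      HasFDerivWithinAt (fun u => Wmap ρ s β (inverse ρ s η β u)) (DB u) (Vseta s η) u ∧
        ‖DB u‖ < Ceta d η := by
  have hp := h.perturbation
  set B := Perturbation.location (dir s) (fun x => β (dir x)) (Real.sin (η / 2)) (ρ / ‖s‖)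
  have hB : ∀ u ∈ Vseta s η, Wmap ρ s β (inverse ρ s η β u) = B (dir u) := fun u hu => by
    rw [(h.backward hu).2.2, dir_of_norm_eq_one (norm_eq_one_of_mem_Vseta hu)]
    rfl
  have hV := fun {u} (hu : u ∈ Vseta s η) => (mem_Vseta_iff h.η_mem h.ne_zero).1 hu
  have hne : ∀ u ∈ Vseta s η, u ≠ 0 := fun u hu =>
    norm_ne_zero_iff.1 ((hV hu).1.trans_ne one_ne_zero)
  have hBd : ∀ u ∈ Vseta s η, ContDiffAt ℝ 1 B (dir u) := fun u hu => by
    rw [dir_of_norm_eq_one (hV hu).1]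
    exact hp.contDiffOn_location.contDiffAt
      ((Perturbation.isOpen_outgoing _ _).mem_nhds (hV hu).2)
  have hcd : ∀ u ∈ Vseta s η, ContDiffAt ℝ 1 (B ∘ dir) u := fun u hu =>
    (hBd u hu).comp u (contDiffAt_dir (hne u hu))
  refine ⟨fderiv ℝ (B ∘ dir), fun u hu => ?_, fun u hu => ⟨?_, ?_⟩⟩
  · exact ((hcd u hu).fderiv_right (m := 0) le_rfl).continuousAt.continuousWithinAt
  · exact ((hcd u hu).differentiableAt one_ne_zero).hasFDerivAt.hasFDerivWithinAt.congr hB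
      (hB u hu)
  · obtain ⟨hu1, hu2⟩ := hV hu
    have h1 : fderiv ℝ (B ∘ dir) u = fderiv ℝ B u ∘L proj u := by
      rw [fderiv_comp u ((hBd u hu).differentiableAt one_ne_zero)
        (hasStrictFDerivAt_dir (hne u hu)).hasFDerivAt.differentiableAt, fderiv_dir (hne u hu),
        derivDir_of_norm_eq_one hu1, dir_of_norm_eq_one hu1]
    have h2 := hp.norm_fderiv_location_sub_le hu2
    have hL := hp.two_le
    have hσ := hp.σ_pos
    have h3 : 14 * L ^ 3 * (ρ / ‖s‖) < 1 := by
      have h4 : L ^ 3 ≤ L ^ 4 := pow_le_pow_right₀ (by linarith) (by norm_num)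
      have h5 := mul_le_mul_of_nonneg_right h4 hσ.le
      have h6 : 0 < L ^ 4 * (ρ / ‖s‖) := by positivity
      linarith [hp.small]
    have h4 := norm_derivDir_sub_comp_proj_le h.η_mem hu1 hp.norm_e
      ((lt_angle_iff h.η_mem hu1 hp.norm_e).2 hu2)
    have h5 : fderiv ℝ B u ∘L proj u = derivDir (u - dir s) ∘L proj u +
        (fderiv ℝ B u - derivDir (u - dir s)) ∘L proj u := by
      rw [ContinuousLinearMap.sub_comp]
      abel
    have h6 : ‖(fderiv ℝ B u - derivDir (u - dir s)) ∘L proj u‖ ≤ 14 * L ^ 3 * (ρ / ‖s‖) * 1 :=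
      (ContinuousLinearMap.opNorm_comp_le _ _).trans
        (mul_le_mul h2 (norm_proj_le hu1) (norm_nonneg _) (by positivity))
    rw [h1, h5]
    linarith [norm_add_le (derivDir (u - dir s) ∘L proj u)
      ((fderiv ℝ B u - derivDir (u - dir s)) ∘L proj u)]

end Scatterer

section Construction

variable {r s : Vec d} {η C : ℝ} {β : Vec d → Vec d}

theorem dir_mem_Vseta (hη : η ∈ Ioo 0 Real.pi) (hs : s ≠ 0) (hrs : 2 * η < angle r s)
    {x : Vec d} (hx0 : x ≠ 0) (hx : x ∈ ball (dir s) (Real.sin (η / 2))) : dir x ∈ Vseta r η := by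
  have he := norm_dir hs
  have h1 : ¬ η < angle (dir x) (dir s) := by
    rw [lt_angle_iff hη (norm_dir hx0) he, not_lt]
    have h2 := norm_dir_sub_dir_le x (dir_ne_zero hs)
    rw [dir_of_norm_eq_one he, he, div_one] at h2
    have h3 := mem_ball_iff_norm.1 hx
    linarith
  rw [angle_dir_right hs, not_lt] at h1
  refine ⟨mem_sphere_zero_iff_norm.2 (norm_dir hx0), ?_⟩
  have h4 := angle_le_angle_add_angle r (dir x) s
  rw [angle_comm r (dir x)] at h4
  linarith

theorem Scatterer.of_bounds {ρ L : ℝ} (hη : η ∈ Ioo 0 1) (hs : s ≠ 0) (hrs : 2 * η < angle r s)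
    (hρ : 0 < ρ) (hLC : 2 * C + 2 ≤ L) (hC : 0 ≤ C) (hLη : (Real.sin (η / 2))⁻¹ ≤ L)
    (hsmall : 1000 * L ^ 4 * (ρ / ‖s‖) ≤ 1) (hβ : ∀ v ∈ Vseta r η, ‖β v‖ ≤ C)
    {Dβ : Vec d → Vec d →L[ℝ] Vec d} (hDc : ContinuousOn Dβ (Vseta r η))
    (hD : ∀ v ∈ Vseta r η, HasFDerivWithinAt β (Dβ v) (Vseta r η) v ∧ ‖Dβ v‖ ≤ C) :
    Scatterer ρ r s η β L := by
  have hηπ : η ∈ Ioo 0 Real.pi := ⟨hη.1, by linarith [hη.2, Real.pi_gt_three]⟩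
  have hsin0 : 0 < Real.sin (η / 2) :=
    Real.sin_pos_of_pos_of_lt_pi (by linarith [hηπ.1]) (by linarith [hηπ.1, hηπ.2])
  have hsin1 : Real.sin (η / 2) < 1 / 2 := by
    have := Real.sin_lt (show 0 < η / 2 by linarith [hη.1])
    linarith [hη.2]
  have hs' := norm_pos_iff.2 hs
  have hnorm : ∀ x ∈ ball (dir s) (Real.sin (η / 2)), 1 / 2 ≤ ‖x‖ := fun x hx => by
    have h1 := mem_ball_iff_norm'.1 hx
    have h2 := norm_sub_norm_le (dir s) x
    rw [norm_dir hs] at h2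
    linarith
  have hne : ∀ x ∈ ball (dir s) (Real.sin (η / 2)), x ≠ 0 := fun x hx =>
    norm_pos_iff.1 (one_half_pos.trans_le (hnorm x hx))
  have hmem : ∀ x ∈ ball (dir s) (Real.sin (η / 2)), dir x ∈ Vseta r η := fun x hx =>
    dir_mem_Vseta hηπ hs hrs (hne x hx) hx
  have hderiv : ∀ x ∈ ball (dir s) (Real.sin (η / 2)),
      HasFDerivAt (fun x => β (dir x)) (Dβ (dir x) ∘L fderiv ℝ dir x) x := fun x hx =>
    (hD _ (hmem x hx)).1.comp_hasFDerivAt x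
      ((contDiffAt_dir (hne x hx) (n := 1)).differentiableAt one_ne_zero).hasFDerivAt
      (eventually_of_mem (isOpen_ball.mem_nhds hx) hmem)
  refine ⟨hs, hρ, hηπ, ⟨norm_dir hs, hsin0, by positivity, hLη, by linarith, ?_, ?_, ?_, hsmall⟩,
    hmem, ?_⟩
  · refine (contDiffOn_succ_iff_fderiv_of_isOpen (n := 0) isOpen_ball).2
      ⟨fun x hx => (hderiv x hx).differentiableAt.differentiableWithinAt, by simp, ?_⟩
    rw [contDiffOn_zero]
    refine ContinuousOn.congr (f := fun x => Dβ (dir x) ∘L fderiv ℝ dir x) ?_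
      fun x hx => (hderiv x hx).fderiv
    refine ContinuousOn.clm_comp (hDc.comp (fun x hx => ?_) hmem) fun x hx => ?_
    · exact (contDiffAt_dir (hne x hx) (n := 0)).continuousAt.continuousWithinAt
    · exact ((contDiffAt_dir (hne x hx) (n := 1)).fderiv_right
        (m := 0) le_rfl).continuousAt.continuousWithinAt
  · intro x hx
    linarith [hβ _ (hmem x hx)]
  · intro x hx
    rw [(hderiv x hx).fderiv, fderiv_dir (hne x hx)]
    calc _ ≤ ‖Dβ (dir x)‖ * ‖derivDir x‖ := ContinuousLinearMap.opNorm_comp_le _ _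
      _ ≤ C * (1 / 2)⁻¹ := by
        gcongr
        · exact (hD _ (hmem x hx)).2
        · exact norm_derivDir_le one_half_pos (hnorm x hx)
      _ ≤ L := by linarith
  · intro v hv
    linarith [hβ v hv]

end Construction

end ScatteringMap

/-- Lemma `SHINELEM1` of Marklof–Strömbergsson: the scattering map off a
single small ball is a C¹ diffeomorphism onto `V_s^η`, transforms the surface measure into
the scattering measure `λ_s` with distortion close to 1, and the impact location map is
C¹-close to the ideal one. -/
theorem statement9 (d : ℕ) (hd : 2 ≤ d) (η : ℝ) (hη : η ∈ Set.Ioo 0 (Real.pi / 100))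
    (C : ℝ) (hC : 10 ≤ C) (ε : ℝ) (hε : 0 < ε) :
    ∃ ρ₀ > (0:ℝ), ∀ ρ ∈ Set.Ioo 0 ρ₀,
      ∀ r s : Vec d, r ≠ 0 → s ≠ 0 → C⁻¹ ≤ ‖s‖ → 2 * η < angle r s →
        ∀ β : Vec d → Vec d, (∀ v ∈ Vseta r η, ‖β v‖ ≤ C) →
          (∃ Dβ : Vec d → Vec d →L[ℝ] Vec d, ContinuousOn Dβ (Vseta r η) ∧
            ∀ v ∈ Vseta r η,
              HasFDerivWithinAt β (Dβ v) (Vseta r η) v ∧ ‖Dβ v‖ ≤ C) →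
          ∃ Vinv : Vec d → Vec d,
            -- (i): `V̄` is a C¹ diffeomorphism from `Δ` onto `V_s^η`
            (Set.BijOn (Vmap ρ s β) (Delta ρ r s η β) (Vseta s η) ∧
              (∀ v ∈ Delta ρ r s η β, Vinv (Vmap ρ s β v) = v) ∧
              (∀ u ∈ Vseta s η, Vinv u ∈ Delta ρ r s η β ∧ Vmap ρ s β (Vinv u) = u) ∧
              C1On (Vmap ρ s β) (Delta ρ r s η β) ∧ C1On Vinv (Vseta s η)) ∧
            -- (ii): distortion of measure close to 1
            (∀ M : Set (Vec d), MeasurableSet M → M ⊆ Vseta s η → 0 < lamS s M →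
              ∃ g : Vec d → ℝ, ContinuousOn g M ∧
                (∀ u ∈ M, g u ∈ Set.Icc (1 - ε) (1 + ε)) ∧
                Measure.map (Vmap ρ s β)
                    ((sphVol d (Delta ρ r s η β ∩ Vmap ρ s β ⁻¹' M))⁻¹ •
                      (sphVol d).restrict (Delta ρ r s η β ∩ Vmap ρ s β ⁻¹' M)) =
                  ((lamS s M)⁻¹ • (lamS s).restrict M).withDensity
                    (fun u => ENNReal.ofReal (g u))) ∧
            -- (iii): the map `B = W ∘ V̄⁻¹` is C¹, close to `β_{ŝ}`, with derivative
            -- bounded by `C_η`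
            ((∀ u ∈ Vseta s η, ‖Wmap ρ s β (Vinv u) - impact (dir s) u‖ < ε) ∧
              ∃ DB : Vec d → Vec d →L[ℝ] Vec d, ContinuousOn DB (Vseta s η) ∧
                ∀ u ∈ Vseta s η,
                  HasFDerivWithinAt (fun u => Wmap ρ s β (Vinv u)) (DB u) (Vseta s η) u ∧
                    ‖DB u‖ < Ceta d η) := by
  have hη1 : η ∈ Ioo 0 1 := ⟨hη.1, by linarith [hη.2, Real.pi_lt_four]⟩
  have hsin : 0 < Real.sin (η / 2) :=
    Real.sin_pos_of_pos_of_lt_pi (by linarith [hη1.1]) (by linarith [hη1.2, Real.pi_gt_three])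
  have hC0 : 0 < C := by linarith
  have hε' : min (1 / 2) (ε / 4) ∈ Ioo (0 : ℝ) 1 :=
    ⟨by positivity, (min_le_left _ _).trans_lt (by norm_num)⟩
  obtain ⟨δ, hδ, hdet⟩ := exists_det_near_one d hε'.1
  set L := (Real.sin (η / 2))⁻¹ + 2 * C + 2
  have hinv := inv_pos.2 hsin
  have hL : 1 ≤ L := by linarith
  have hκ : 0 < min 1 (min ε δ) := by positivity
  refine ⟨min 1 (min ε δ) / (1000 * L ^ 4 * C), by positivity, ?_⟩
  rintro ρ ⟨hρ, hρ₀⟩ r s - hs hsC hrs β hβ ⟨Dβ, hDc, hD⟩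
  have hσ : ρ / ‖s‖ ≤ C * ρ := by
    rw [div_eq_inv_mul]
    exact mul_le_mul_of_nonneg_right (inv_le_of_inv_le₀ hC0 hsC) hρ.le
  have hσ0 : 0 < ρ / ‖s‖ := div_pos hρ (norm_pos_iff.2 hs)
  have hsmall : 1000 * L ^ 4 * (ρ / ‖s‖) < min 1 (min ε δ) := by
    rw [lt_div_iff₀ (by positivity)] at hρ₀
    calc _ ≤ 1000 * L ^ 4 * (C * ρ) := by gcongr
      _ < _ := by linarith
  obtain ⟨hsmall1, hsmallε, hsmallδ⟩ := by simpa only [lt_min_iff] using hsmall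
  have h : Scatterer ρ r s η β L := Scatterer.of_bounds hη1 hs hrs hρ (by linarith) hC0.le
    (by linarith) hsmall1.le hβ hDc hD
  have hL2 : L ^ 2 * (ρ / ‖s‖) ≤ L ^ 4 * (ρ / ‖s‖) :=
    mul_le_mul_of_nonneg_right (pow_le_pow_right₀ hL (by norm_num)) hσ0.le
  have hL0 : 0 < L ^ 4 * (ρ / ‖s‖) := by positivity
  refine ⟨Scatterer.inverse ρ s η β, ⟨h.bijOn_Vmap, fun v hv => h.inverse_Vmap hv,
    fun u hu => ⟨(h.backward hu).1, (h.backward hu).2.1⟩, h.c1On_Vmap, h.c1On_inverse⟩,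
    fun M hM hMV hpos => h.exists_density (by lia) hε' ?_ hdet (by linarith) hM hMV hpos,
    fun u hu => h.norm_Wmap_inverse_sub_lt (by linarith) hu, h.exists_deriv_Wmap_inverse⟩
  have h1 := min_le_left (1 / 2) (ε / 4)
  have h2 := min_le_right (1 / 2) (ε / 4)
  nlinarith
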